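/- arXiv:1006.2671 — 2 statements merged into one kernel-verified Lean document; each statement's English description precedes it below -/
import Mathlib

section
/- (Density Halpern–Läuchli Theorem, DHL(d).) For every d ≥ 1, every vector homogeneous tree (T_1,…,T_d) and every subset D of the level product ⊗(T_1,…,T_d) satisfying limsup_{n→∞} |D ∩ (T_1(n)×⋯×T_d(n))| / |T_1(n)×⋯×T_d(n)| > 0, there exists a vector strong subtree (S_1,…,S_d) of (T_1,…,T_d) such that the level product ⊗(S_1,…,S_d) is contained in D. -/
open Filter

namespace DHLPaper

/-- The tree `b^{<ℕ}` of all finite sequences with values in `{0,…,b−1}`,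
partially ordered by end-extension (`List.IsPrefix`, written `<+:`). -/
def bSeq (b : ℕ) : Set (List ℕ) := {t | ∀ x ∈ t, x < b}

/-- The set of successors of `t` in `T`: `Suc_T(t) = {s ∈ T : t ≤ s}`. -/
def suc (T : Set (List ℕ)) (t : List ℕ) : Set (List ℕ) := {s ∈ T | t <+: s}

/-- `s` is an immediate successor of `t` in `T`. -/
def ImmSuc (T : Set (List ℕ)) (t s : List ℕ) : Prop :=
  t ∈ T ∧ s ∈ T ∧ t <+: s ∧ t ≠ s ∧ ∀ u ∈ T, t <+: u → u <+: s → u = t ∨ u = s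

/-- The `n`-th level of `T`: the nodes of `T` with exactly `n` strict predecessors in `T`. -/
def level (T : Set (List ℕ)) (n : ℕ) : Set (List ℕ) :=
  {t ∈ T | {s ∈ T | s <+: t ∧ s ≠ t}.ncard = n}

/-- `T` has exactly one minimal node. -/
def UniquelyRooted (T : Set (List ℕ)) : Prop := ∃! r, r ∈ level T 0

/-- Every node of `T` has finitely many immediate successors in `T`. -/
def FinitelyBranching (T : Set (List ℕ)) : Prop := ∀ t ∈ T, {s | ImmSuc T t s}.Finite

/-- Every node of `T` has at least one immediate successor in `T`. -/
def Pruned (T : Set (List ℕ)) : Prop := ∀ t ∈ T, ∃ s, ImmSuc T t s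

/-- `S` is a strong subtree of `T` whose level set `L_T(S)` is enumerated by the strictly
increasing map `l`: `S(n) ⊆ T(l n)` for every `n`, `S` is uniquely rooted, and for every
`s ∈ S` and every immediate successor `t` of `s` in `T` there is a unique immediate
successor `s'` of `s` in `S` with `t ≤ s'`. -/
def IsStrongSubtreeWith (T S : Set (List ℕ)) (l : ℕ → ℕ) : Prop :=
  S ⊆ T ∧ UniquelyRooted S ∧ StrictMono l ∧
    (∀ n, level S n ⊆ level T (l n)) ∧
    (∀ s ∈ S, ∀ t, ImmSuc T s t → ∃! s', ImmSuc S s s' ∧ t <+: s')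

/-- `S` is a strong subtree of `T`. -/
def IsStrongSubtree (T S : Set (List ℕ)) : Prop := ∃ l, IsStrongSubtreeWith T S l

/-- A homogeneous tree with branching number `b`: a strong subtree of `b^{<ℕ}`, `b ≥ 2`. -/
def IsHomogeneous (b : ℕ) (T : Set (List ℕ)) : Prop := 2 ≤ b ∧ IsStrongSubtree (bSeq b) T

/-- A vector homogeneous tree: a `d`-tuple of homogeneous trees. -/
def IsVecHomogeneous {d : ℕ} (b : Fin d → ℕ) (T : Fin d → Set (List ℕ)) : Prop :=
  ∀ i, IsHomogeneous (b i) (T i)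

/-- Vector strong subtree: componentwise strong subtrees with a common level set. -/
def IsVecStrongSubtree {d : ℕ} (T S : Fin d → Set (List ℕ)) : Prop :=
  ∃ l, ∀ i, IsStrongSubtreeWith (T i) (S i) l

/-- `⊗T(n) = T_1(n) × ⋯ × T_d(n)`. -/
def vecLevel {d : ℕ} (T : Fin d → Set (List ℕ)) (n : ℕ) : Set (Fin d → List ℕ) :=
  {v | ∀ i, v i ∈ level (T i) n}

/-- The level product `⊗T = ⋃_n ⊗T(n)`. -/
def levelProd {d : ℕ} (T : Fin d → Set (List ℕ)) : Set (Fin d → List ℕ) :=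
  ⋃ n, vecLevel T n

/-- `r` is the root tuple of the vector tree `T`. -/
def IsRoot {d : ℕ} (T : Fin d → Set (List ℕ)) (r : Fin d → List ℕ) : Prop :=
  ∀ i, level (T i) 0 = {r i}

/-- `F` is a vector fan of `T`: `F = (R_1(0) ∪ R_1(1), …, R_d(0) ∪ R_d(1))` for some
vector strong subtree `R` of `T`. -/
def IsVecFan {d : ℕ} (T F : Fin d → Set (List ℕ)) : Prop :=
  ∃ R : Fin d → Set (List ℕ), IsVecStrongSubtree T R ∧
    ∀ i, F i = level (R i) 0 ∪ level (R i) 1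

/-- `fan(T,n)`: the vector fans of `T` with `⊗F(1) ⊆ ⊗T(n)`. -/
def fanAt {d : ℕ} (T : Fin d → Set (List ℕ)) (n : ℕ) : Set (Fin d → Set (List ℕ)) :=
  {F | IsVecFan T F ∧ vecLevel F 1 ⊆ vecLevel T n}

/-- Density of `F ⊆ W(n)` in the `n`-th level of `W`. -/
noncomputable def dens (W : Set (List ℕ)) (n : ℕ) (F : Set (List ℕ)) : ℝ :=
  (F.ncard : ℝ) / ((level W n).ncard : ℝ)

/-- Density of `F ⊆ W(n)` relative to the node `w`. -/
noncomputable def densRel (W : Set (List ℕ)) (n : ℕ) (F : Set (List ℕ)) (w : List ℕ) : ℝ :=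
  ((F ∩ suc W w).ncard : ℝ) / ((level W n ∩ suc W w).ncard : ℝ)

/-- `s = w ⌢_W p`: `s` is the immediate successor of `w` in `W` such that the
concatenation `w ⌢ p` is an initial segment of `s`. -/
def IsConcat (W : Set (List ℕ)) (w : List ℕ) (p : ℕ) (s : List ℕ) : Prop :=
  ImmSuc W w s ∧ w ++ [p] <+: s

/-- The density Halpern–Läuchli statement in dimension `d`. -/
def DHL (d : ℕ) : Prop :=
  ∀ (b : Fin d → ℕ) (T : Fin d → Set (List ℕ)), IsVecHomogeneous b T →
    ∀ D : Set (Fin d → List ℕ), D ⊆ levelProd T →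
      0 < Filter.limsup
          (fun n => ((D ∩ vecLevel T n).ncard : ℝ) / ((vecLevel T n).ncard : ℝ)) atTop →
      ∃ S : Fin d → Set (List ℕ), IsVecStrongSubtree T S ∧ levelProd S ⊆ D

/-- `D : ⊗T → 2^W` is an `ε`-dense level selection along the strictly increasing
sequence `l`: for every `n` and every `t⃗ ∈ ⊗T(n)`, `D(t⃗) ⊆ W(l n)` and
`dens(D(t⃗)) ≥ ε`. -/
def IsDenseLevelSel {d : ℕ} (T : Fin d → Set (List ℕ)) (W : Set (List ℕ)) (l : ℕ → ℕ)
    (ε : ℝ) (D : (Fin d → List ℕ) → Set (List ℕ)) : Prop :=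
  StrictMono l ∧ ∀ n, ∀ v ∈ vecLevel T n, D v ⊆ level W (l n) ∧ ε ≤ dens W (l n) (D v)

/-- The pair `(R, w)` (`R` a vector strong subtree of `T` with root tuple `r0`) is strongly
`θ`-correlated with respect to the dense level selection `D` (with level sequence `l`):
`w ∈ D(r0)` and for every vector fan `F` of `R` with `F(0) = r0` and every `p < b_W`,
`dens(⋂_{r ∈ ⊗F(1)} D(r) | w ⌢_W p) ≥ θ`. -/
def StronglyCorrelated {d : ℕ} (T : Fin d → Set (List ℕ)) (W : Set (List ℕ)) (bW : ℕ)
    (l : ℕ → ℕ) (D : (Fin d → List ℕ) → Set (List ℕ)) (R : Fin d → Set (List ℕ))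
    (r0 : Fin d → List ℕ) (w : List ℕ) (θ : ℝ) : Prop :=
  w ∈ D r0 ∧
    ∀ F : Fin d → Set (List ℕ), IsVecFan R F → IsRoot F r0 →
      ∀ n, vecLevel F 1 ⊆ vecLevel T n →
        ∀ p < bW, ∀ s, IsConcat W w p s →
          θ ≤ densRel W (l n) (⋂ r ∈ vecLevel F 1, D r) s

/-! ### Averages over words of a fixed length -/

/-- The average of `F` over all words of length `n` in the alphabet `α`. -/
noncomputable def avg {α : Type*} [Fintype α] : ℕ → (List α → ℝ) → ℝ
  | 0, F => F []
  | n + 1, F => (∑ a, avg n (fun t => F (a :: t))) / Fintype.card α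

section Avg

variable {α β : Type*} [Fintype α] [Fintype β]

lemma avg_add_fun (n : ℕ) (F G : List α → ℝ) :
    avg n (fun t => F t + G t) = avg n F + avg n G := by
  induction n generalizing F G with
  | zero => rfl
  | succ n ih => simp only [avg, ih, Finset.sum_add_distrib, add_div]

lemma avg_const_mul (n : ℕ) (c : ℝ) (F : List α → ℝ) :
    avg n (fun t => c * F t) = c * avg n F := by
  induction n generalizing F with
  | zero => rfl
  | succ n ih => simp only [avg, ih, ← Finset.mul_sum, mul_div_assoc]

lemma avg_sub_fun (n : ℕ) (F G : List α → ℝ) :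
    avg n (fun t => F t - G t) = avg n F - avg n G := by
  have h := avg_add_fun n F (fun t => (-1) * G t)
  rw [avg_const_mul] at h
  simpa [sub_eq_add_neg] using h

lemma avg_sum {ι : Type*} (s : Finset ι) (n : ℕ) (F : ι → List α → ℝ) :
    avg n (fun t => ∑ i ∈ s, F i t) = ∑ i ∈ s, avg n (F i) := by
  classical
  induction s using Finset.induction_on with
  | empty => simpa using avg_const_mul n 0 (fun _ : List α => (0 : ℝ))
  | insert i s hi ih => simp only [Finset.sum_insert hi, avg_add_fun, ih]

lemma avg_mono {n : ℕ} {F G : List α → ℝ} (h : ∀ t, t.length = n → F t ≤ G t) :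
    avg n F ≤ avg n G := by
  induction n generalizing F G with
  | zero => exact h [] rfl
  | succ n ih =>
    simp only [avg]
    gcongr with a
    exact ih fun t ht => h _ (by simp [ht])

lemma avg_congr {n : ℕ} {F G : List α → ℝ} (h : ∀ t, t.length = n → F t = G t) :
    avg n F = avg n G :=
  le_antisymm (avg_mono fun t ht => (h t ht).le) (avg_mono fun t ht => (h t ht).ge)

lemma avg_const [Nonempty α] (n : ℕ) (c : ℝ) : avg n (fun _ : List α => c) = c := by
  induction n with
  | zero => rfl
  | succ n ih =>
    have : (Fintype.card α : ℝ) ≠ 0 := by exact_mod_cast Fintype.card_ne_zero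
    simp [avg, ih, this]

lemma avg_nonneg {n : ℕ} {F : List α → ℝ} (h : ∀ t, 0 ≤ F t) : 0 ≤ avg n F := by
  have := avg_mono (n := n) (F := fun t => 0 * F t) (G := F) (fun t _ => by simpa using h t)
  rwa [avg_const_mul, zero_mul] at this

lemma avg_le_one [Nonempty α] {n : ℕ} {F : List α → ℝ} (h : ∀ t, F t ≤ 1) : avg n F ≤ 1 := by
  simpa only [avg_const] using avg_mono (n := n) (F := F) (G := fun _ => 1) (fun t _ => h t)

lemma avg_append (m k : ℕ) (F : List α → ℝ) :
    avg (m + k) F = avg m (fun s => avg k (fun t => F (s ++ t))) := by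
  induction m generalizing F with
  | zero => simp [avg]
  | succ m ih =>
    rw [Nat.succ_add]
    simp only [avg, ih, List.cons_append]

lemma avg_snoc (m : ℕ) (F : List α → ℝ) :
    avg (m + 1) F = avg m (fun s => (∑ a, F (s ++ [a])) / Fintype.card α) := by
  rw [avg_append]
  rfl

lemma avg_take [Nonempty α] {m M : ℕ} (h : m ≤ M) (F : List α → ℝ) :
    avg M (fun t => F (t.take m)) = avg m F := by
  obtain ⟨k, rfl⟩ := Nat.exists_eq_add_of_le h
  rw [avg_append]
  refine avg_congr fun s hs => ?_
  subst hs
  simp [avg_const]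

lemma avg_map_equiv (e : α ≃ β) (n : ℕ) (F : List β → ℝ) :
    avg n (fun t => F (t.map e)) = avg n F := by
  induction n generalizing F with
  | zero => rfl
  | succ n ih =>
    simp only [avg, List.map_cons, Fintype.card_congr e]
    congr 1
    rw [← Equiv.sum_comp e]
    exact Finset.sum_congr rfl fun a _ => ih (fun t => F (e a :: t))

lemma avg_eq_sum (n : ℕ) (F : List α → ℝ) :
    avg n F = (∑ x : Fin n → α, F (List.ofFn x)) / (Fintype.card α : ℝ) ^ n := by
  induction n generalizing F with
  | zero => simp [avg]
  | succ n ih =>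
    simp only [avg, ih]
    rw [← Finset.sum_div, div_div, ← pow_succ]
    congr 1
    rw [← (Fin.consEquiv fun _ : Fin (n + 1) => α).sum_comp, Fintype.sum_prod_type]
    refine Finset.sum_congr rfl fun a _ => Finset.sum_congr rfl fun x _ => ?_
    simp [Fin.consEquiv, List.ofFn_succ]

end Avg

/-! ### A generalized Cauchy–Schwarz inequality for grids -/

lemma sum_sum_update {A : Type*} [DecidableEq A] [Fintype A] {Y : A → Type*}
    [∀ a, Fintype (Y a)] (a : A) (h : (∀ a, Y a) → ℝ) :
    ∑ x, ∑ y, h (Function.update x a y) = Fintype.card (Y a) * ∑ x, h x := by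
  have e : Function.Involutive
      (fun z : (∀ a, Y a) × Y a => (Function.update z.1 a z.2, z.1 a)) := by
    rintro ⟨x, y⟩
    simp
  have h1 : ∑ z : (∀ a, Y a) × Y a, h (Function.update z.1 a z.2) =
      ∑ z : (∀ a, Y a) × Y a, h z.1 :=
    Fintype.sum_equiv e.toPerm _ _ fun _ => rfl
  rw [← Fintype.sum_prod_type' (fun x y => h (Function.update x a y)), h1,
    Fintype.sum_prod_type]
  simp [Finset.mul_sum]

lemma prod_le_sum_pow_card {Q : Type*} [Fintype Q] [Nonempty Q] (z : Q → ℝ)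
    (hz : ∀ q, 0 ≤ z q) :
    ∏ q, z q ≤ (∑ q, z q ^ Fintype.card Q) / Fintype.card Q := by
  have hQ : (Fintype.card Q : ℝ) ≠ 0 := by exact_mod_cast Fintype.card_ne_zero
  have h := Real.geom_mean_le_arith_mean_weighted Finset.univ
    (fun _ : Q => (Fintype.card Q : ℝ)⁻¹) (fun q => z q ^ Fintype.card Q)
    (fun _ _ => by positivity) (by simp [hQ]) (fun q _ => pow_nonneg (hz q) _)
  rw [← Finset.mul_sum, mul_comm, ← div_eq_mul_inv] at h
  simpa only [Real.pow_rpow_inv_natCast (hz _) Fintype.card_ne_zero] using h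

section Grid

variable {A : Type*} [Fintype A] [DecidableEq A] {P X : A → Type*}
  [∀ a, Fintype (P a)] [∀ a, DecidableEq (P a)] [∀ a, Nonempty (P a)]
  [∀ a, Fintype (X a)] [∀ a, Nonempty (X a)]

lemma sum_prod_grid_le_coord (a : A) (f : (∀ a, P a) → (∀ a, X a) → ℝ)
    (hf : ∀ π x, 0 ≤ f π x) :
    ∑ x : ∀ a, P a → X a, ∏ π, f π (fun a => x a (π a)) ≤
      (∑ q, ∑ x : ∀ a, P a → X a, ∏ π, f (Function.update π a q) (fun a => x a (π a))) /
        Fintype.card (P a) := by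
  have hupd : ∀ (x : ∀ a, P a → X a) (y : P a → X a) (π : ∀ a, P a),
      (fun c => Function.update x a y c (π c)) =
        Function.update (fun c => x c (π c)) a (y (π a)) := by
    intro x y π
    ext c
    by_cases h : c = a
    · subst h; simp
    · simp [h]
  have key : ∀ x : ∀ a, P a → X a,
      ∑ y, ∏ π, f π (fun c => Function.update x a y c (π c)) ≤
        (∑ q, ∑ y, ∏ π, f (Function.update π a q)
          (fun c => Function.update x a y c (π c))) / Fintype.card (P a) := by
    intro x
    let F : P a → X a → ℝ := fun q z =>
      ∏ π with π a = q, f π (Function.update (fun c => x c (π c)) a z)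
    have hF : ∀ q z, 0 ≤ F q z := fun q z => Finset.prod_nonneg fun _ _ => hf _ _
    have h1 : ∀ y : P a → X a,
        ∏ π, f π (fun c => Function.update x a y c (π c)) = ∏ q, F q (y q) := by
      intro y
      rw [← Finset.prod_fiberwise Finset.univ (fun π : ∀ a, P a => π a)]
      refine Finset.prod_congr rfl fun q _ => Finset.prod_congr rfl fun π hπ => ?_
      rw [hupd, (Finset.mem_filter.1 hπ).2]
    have h2 : ∀ (q : P a) (y : P a → X a),
        ∏ π, f (Function.update π a q) (fun c => Function.update x a y c (π c)) =
          ∏ q', F q (y q') := by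
      intro q y
      rw [← Finset.prod_fiberwise Finset.univ (fun π : ∀ a, P a => π a)]
      refine Finset.prod_congr rfl fun q' _ => ?_
      refine Finset.prod_bij' (fun π _ => Function.update π a q)
        (fun π _ => Function.update π a q') ?_ ?_ ?_ ?_ ?_
      · intro π _; simp
      · intro π _; simp
      · intro π hπ
        have := (Finset.mem_filter.1 hπ).2
        simp [← this]
      · intro π hπ
        have := (Finset.mem_filter.1 hπ).2
        simp [← this]
      · intro π hπ
        rw [hupd, (Finset.mem_filter.1 hπ).2]
        congr 1
        ext c
        by_cases h : c = a
        · subst h; simp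
        · simp [h]
    have h3 : ∀ H : P a → X a → ℝ, ∑ y : P a → X a, ∏ q, H q (y q) = ∏ q, ∑ z, H q z := by
      intro H
      rw [Finset.prod_univ_sum]
      simp
    simp only [h1, h2]
    rw [h3]
    refine (prod_le_sum_pow_card _ fun q => Finset.sum_nonneg fun z _ => hF q z).trans_eq ?_
    congr 1
    refine Finset.sum_congr rfl fun q _ => ?_
    rw [h3 (fun _ => F q)]
    simp
  have hcard : (0 : ℝ) < Fintype.card (P a → X a) := by exact_mod_cast Fintype.card_pos
  refine le_of_mul_le_mul_left ?_ hcard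
  rw [← sum_sum_update a (fun x : ∀ a, P a → X a => ∏ π, f π (fun a => x a (π a))),
    ← mul_div_assoc, Finset.mul_sum]
  simp only [← sum_sum_update a (fun x : ∀ a, P a → X a =>
    ∏ π, f (Function.update π a _) (fun a => x a (π a)))]
  conv_rhs => rw [Finset.sum_comm]
  rw [Finset.sum_div]
  exact Finset.sum_le_sum fun x _ => key x

lemma sum_prod_grid_le (f : (∀ a, P a) → (∀ a, X a) → ℝ) (hf : ∀ π x, 0 ≤ f π x) :
    ∑ x : ∀ a, P a → X a, ∏ π, f π (fun a => x a (π a)) ≤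
      (∑ ρ, ∑ x : ∀ a, P a → X a, ∏ π : ∀ a, P a, f ρ (fun a => x a (π a))) /
        Fintype.card (∀ a, P a) := by
  have hK : (0 : ℝ) < Fintype.card (∀ a, P a) := by exact_mod_cast Fintype.card_pos
  have main : ∀ S : Finset A, ∑ x : ∀ a, P a → X a, ∏ π, f π (fun a => x a (π a)) ≤
      (∑ ρ, ∑ x : ∀ a, P a → X a, ∏ π : ∀ a, P a, f (S.piecewise ρ π) (fun a => x a (π a))) /
        Fintype.card (∀ a, P a) := by
    intro S
    induction S using Finset.induction_on with
    | empty =>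
      simp only [Finset.piecewise_empty, Finset.sum_const, Finset.card_univ, nsmul_eq_mul]
      rw [mul_div_cancel_left₀ _ hK.ne']
    | insert a S ha ih =>
      refine ih.trans ?_
      gcongr ?_ / _
      have hP : (0 : ℝ) < Fintype.card (P a) := by exact_mod_cast Fintype.card_pos
      refine (Finset.sum_le_sum fun ρ _ => sum_prod_grid_le_coord a
        (fun π => f (S.piecewise ρ π)) (fun _ _ => hf _ _)).trans_eq ?_
      rw [← Finset.sum_div, div_eq_iff hP.ne', mul_comm,
        ← sum_sum_update a (fun ρ => ∑ x : ∀ a, P a → X a,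
          ∏ π : ∀ a, P a, f ((insert a S).piecewise ρ π) (fun a => x a (π a)))]
      refine Finset.sum_congr rfl fun ρ _ => Finset.sum_congr rfl fun q _ =>
        Finset.sum_congr rfl fun x _ => Finset.prod_congr rfl fun π _ => ?_
      congr 1
      ext c
      by_cases h : c = a
      · subst h; simp [ha]
      · simp [Finset.piecewise, h]
  simpa using main Finset.univ

end Grid

/-! ### Densities of grids in cells of a product of trees -/

section Cells

variable {A : Type*} [Fintype A] [DecidableEq A] {P : A → Type*}
  [∀ a, Fintype (P a)] [∀ a, DecidableEq (P a)]

/-- Coordinatewise evaluation of a tuple of self-maps. -/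
def act (φ : ∀ a, P a → P a) (π : ∀ a, P a) : ∀ a, P a := fun a => φ a (π a)

lemma avg_grid_le [∀ a, Nonempty (P a)] (k : ℕ) (F : (∀ a, P a) → List (∀ a, P a) → ℝ)
    (hF : ∀ π x, 0 ≤ F π x) :
    avg k (fun ψ : List (∀ a, P a → P a) => ∏ π : ∀ a, P a, F π (ψ.map (act · π))) ≤
      (∑ ρ, avg k (fun ψ : List (∀ a, P a → P a) =>
        ∏ π : ∀ a, P a, F ρ (ψ.map (act · π)))) / Fintype.card (∀ a, P a) := by
  let e : (∀ a, P a → Fin k → P a) ≃ (Fin k → ∀ a, P a → P a) :=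
    { toFun := fun x j a p => x a p j
      invFun := fun ψ a p j => ψ j a p
      left_inv := fun _ => rfl
      right_inv := fun _ => rfl }
  have h := sum_prod_grid_le (P := P) (X := fun a => Fin k → P a)
    (fun π y => F π (List.ofFn fun j a => y a j)) (fun _ _ => hF _ _)
  simp only [avg_eq_sum, List.map_ofFn]
  rw [← Finset.sum_div, div_right_comm]
  gcongr ?_ / _
  simp only [← e.sum_comp]
  exact h

lemma sum_act_div_card [∀ a, AddGroup (P a)] (π : ∀ a, P a) (h : (∀ a, P a) → ℝ) :
    (∑ φ, h (act φ π)) / Fintype.card (∀ a, P a → P a) =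
      (∑ c, h c) / Fintype.card (∀ a, P a) := by
  have hK : (Fintype.card (∀ a, P a) : ℝ) ≠ 0 := by exact_mod_cast Fintype.card_ne_zero
  have hM : (Fintype.card (∀ a, P a → P a) : ℝ) ≠ 0 := by exact_mod_cast Fintype.card_ne_zero
  have h1 : ∀ c : ∀ a, P a, ∑ φ, h (act φ π) = ∑ φ, h (c + act φ π) := fun c =>
    (Fintype.sum_equiv (Equiv.addLeft (fun (a : A) (_ : P a) => c a)) _ _ fun _ => rfl).symm
  have h2 : ∀ φ, ∑ c, h (c + act φ π) = ∑ c, h c := fun φ =>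
    Fintype.sum_equiv (Equiv.addRight (act φ π)) _ _ fun _ => rfl
  have h3 : ∑ _c : ∀ a, P a, ∑ φ, h (act φ π) = ∑ φ : ∀ a, P a → P a, ∑ c, h c := by
    rw [Finset.sum_congr rfl fun c _ => h1 c, Finset.sum_comm]
    exact Finset.sum_congr rfl fun φ _ => h2 φ
  simp only [Finset.sum_const, Finset.card_univ, nsmul_eq_mul] at h3
  rw [div_eq_div_iff hM hK, mul_comm, h3, mul_comm]

lemma avg_map_act [∀ a, AddGroup (P a)] (π : ∀ a, P a) (k : ℕ) (F : List (∀ a, P a) → ℝ) :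
    avg k (fun ψ : List (∀ a, P a → P a) => F (ψ.map (act · π))) = avg k F := by
  induction k generalizing F with
  | zero => rfl
  | succ k ih =>
    simp only [avg, List.map_cons]
    rw [← sum_act_div_card π (fun c => avg k fun t => F (c :: t))]
    congr 1
    exact Finset.sum_congr rfl fun φ _ => ih (fun t => F (act φ π :: t))

/-- The average of `f` at relative height `k` in the cell `t`. -/
noncomputable def cellAvg (f : List (∀ a, P a) → ℝ) (k : ℕ) (t : List (∀ a, P a)) : ℝ :=
  avg k fun x => f (t ++ x)

/-- The grid average of `f` at relative height `k`, all grid lines lying in the cell `t`. -/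
noncomputable def gridAvg (f : List (∀ a, P a) → ℝ) (k : ℕ) (t : List (∀ a, P a)) : ℝ :=
  avg k fun ψ : List (∀ a, P a → P a) => ∏ π : ∀ a, P a, f (t ++ ψ.map (act · π))

/-- The grid average of `f` at relative height `k` above the immediate successors of the cell
`t`, with one grid line above each immediate successor. -/
noncomputable def fanAvg (f : List (∀ a, P a) → ℝ) (k : ℕ) (t : List (∀ a, P a)) : ℝ :=
  avg k fun ψ : List (∀ a, P a → P a) => ∏ π : ∀ a, P a, f (t ++ π :: ψ.map (act · π))

/-- The increment of the grid average when passing from a cell to its immediate successors. -/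
noncomputable def gridIncr (f : List (∀ a, P a) → ℝ) (k : ℕ) (t : List (∀ a, P a)) : ℝ :=
  (∑ c, gridAvg f k (t ++ [c])) / Fintype.card (∀ a, P a) - gridAvg f (k + 1) t

variable [∀ a, AddGroup (P a)] {f : List (∀ a, P a) → ℝ}

lemma cellAvg_pow_le_gridAvg (hf : ∀ t, 0 ≤ f t) (k : ℕ) (t : List (∀ a, P a)) :
    cellAvg f k t ^ Fintype.card (∀ a, P a) ≤ gridAvg f k t := by
  set K := Fintype.card (∀ a, P a) with hKdef
  have hK : K ≠ 0 := Fintype.card_ne_zero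
  have hK0 : (0 : ℝ) < K := by exact_mod_cast Nat.pos_of_ne_zero hK
  have hG : 0 ≤ gridAvg f k t := avg_nonneg fun _ => Finset.prod_nonneg fun _ _ => hf _
  have hg : 0 ≤ cellAvg f k t := avg_nonneg fun _ => hf _
  rcases hg.eq_or_lt with h0 | h0
  · rwa [← h0, zero_pow hK]
  set g := cellAvg f k t with hgdef
  obtain ⟨L, hL⟩ := Nat.exists_eq_succ_of_ne_zero hK
  obtain ⟨μ, hμ, hμK⟩ : ∃ μ : ℝ, 0 < μ ∧ μ ^ K = g :=
    ⟨g ^ (K : ℝ)⁻¹, Real.rpow_pos_of_pos h0 _, Real.rpow_inv_natCast_pow hg hK⟩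
  let ρ₀ : ∀ a, P a := 0
  let F : (∀ a, P a) → List (∀ a, P a) → ℝ := fun ρ x =>
    if ρ = ρ₀ then (μ ^ L)⁻¹ * f (t ++ x) else μ
  have h := avg_grid_le k F (fun ρ x => by
    simp only [F]
    split_ifs
    · exact mul_nonneg (by positivity) (hf _)
    · exact hμ.le)
  have hleft : avg k (fun ψ : List (∀ a, P a → P a) =>
      ∏ π : ∀ a, P a, F π (ψ.map (act · π))) = g := by
    rw [hgdef, cellAvg, ← avg_map_act ρ₀]
    refine avg_congr fun ψ _ => ?_
    rw [← Finset.mul_prod_erase _ _ (Finset.mem_univ ρ₀)]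
    have : ∏ π ∈ Finset.univ.erase ρ₀, F π (ψ.map (act · π)) = μ ^ L := by
      rw [Finset.prod_congr rfl (g := fun _ => μ)
        fun π hπ => if_neg (Finset.ne_of_mem_erase hπ)]
      rw [Finset.prod_const, Finset.card_erase_of_mem (Finset.mem_univ _), Finset.card_univ,
        ← hKdef, hL, Nat.succ_sub_one]
    rw [this]
    simp only [F, if_true]
    field_simp
  have hright : ∀ ρ, avg k (fun ψ : List (∀ a, P a → P a) =>
      ∏ π : ∀ a, P a, F ρ (ψ.map (act · π))) =
        if ρ = ρ₀ then (g ^ L)⁻¹ * gridAvg f k t else g := by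
    intro ρ
    by_cases hρ : ρ = ρ₀
    · simp only [F, hρ, if_true, Finset.prod_mul_distrib, Finset.prod_const, Finset.card_univ,
        avg_const_mul, gridAvg]
      rw [← hKdef, inv_pow, ← pow_mul, mul_comm L, pow_mul, hμK]
    · simp only [F, hρ, if_false, Finset.prod_const, Finset.card_univ, avg_const]
      exact hμK
  rw [hleft] at h
  simp only [hright] at h
  rw [← Finset.add_sum_erase _ _ (Finset.mem_univ ρ₀), if_pos rfl,
    Finset.sum_congr rfl (g := fun _ => g)
      fun π hπ => if_neg (Finset.ne_of_mem_erase hπ),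
    Finset.sum_const, Finset.card_erase_of_mem (Finset.mem_univ _), Finset.card_univ,
    ← hKdef, le_div_iff₀ hK0, hL, Nat.succ_sub_one, nsmul_eq_mul] at h
  have h' : g ≤ (g ^ L)⁻¹ * gridAvg f k t := by
    push_cast at h
    linarith
  rw [hL, pow_succ, mul_comm]
  rw [inv_mul_eq_div, le_div_iff₀ (by positivity)] at h'
  exact h'

lemma gridIncr_eq (k : ℕ) (t : List (∀ a, P a)) :
    gridIncr f k t = (∑ φ : ∀ a, P a → P a,
      ((∑ π, gridAvg f k (t ++ [act φ π])) / Fintype.card (∀ a, P a) -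
        avg k fun ψ : List (∀ a, P a → P a) =>
          ∏ π : ∀ a, P a, f (t ++ act φ π :: ψ.map (act · π)))) /
      Fintype.card (∀ a, P a → P a) := by
  have hK : (Fintype.card (∀ a, P a) : ℝ) ≠ 0 := by exact_mod_cast Fintype.card_ne_zero
  rw [Finset.sum_sub_distrib, sub_div, gridIncr]
  congr 1
  have h : (∑ π, ∑ φ, gridAvg f k (t ++ [act φ π])) / Fintype.card (∀ a, P a → P a) =
      ∑ c, gridAvg f k (t ++ [c]) := by
    rw [Finset.sum_div, Finset.sum_congr rfl fun π _ =>
      sum_act_div_card π (fun c => gridAvg f k (t ++ [c]))]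
    rw [Finset.sum_const, Finset.card_univ, nsmul_eq_mul, mul_div_cancel₀ _ hK]
  rw [← Finset.sum_div, Finset.sum_comm, div_right_comm, h]

lemma avg_fan_le (hf : ∀ t, 0 ≤ f t) (k : ℕ) (t : List (∀ a, P a)) (φ : ∀ a, P a → P a) :
    avg k (fun ψ : List (∀ a, P a → P a) =>
      ∏ π : ∀ a, P a, f (t ++ act φ π :: ψ.map (act · π))) ≤
      (∑ π, gridAvg f k (t ++ [act φ π])) / Fintype.card (∀ a, P a) := by
  simpa [gridAvg] using avg_grid_le k (fun ρ x => f (t ++ act φ ρ :: x)) (fun _ _ => hf _)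

lemma gridIncr_nonneg (hf : ∀ t, 0 ≤ f t) (k : ℕ) (t : List (∀ a, P a)) :
    0 ≤ gridIncr f k t := by
  rw [gridIncr_eq]
  exact div_nonneg (Finset.sum_nonneg fun φ _ => sub_nonneg.2 (avg_fan_le hf k t φ))
    (Nat.cast_nonneg _)

lemma cellAvg_pow_le_fanAvg_add (hf : ∀ t, 0 ≤ f t) (k : ℕ) (t : List (∀ a, P a)) :
    cellAvg f (k + 1) t ^ Fintype.card (∀ a, P a) ≤
      fanAvg f k t + Fintype.card (∀ a, P a → P a) * gridIncr f k t := by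
  have hM : (0 : ℝ) < Fintype.card (∀ a, P a → P a) := by exact_mod_cast Fintype.card_pos
  have h1 := cellAvg_pow_le_gridAvg hf (k + 1) t
  have h2 := gridIncr_nonneg hf k t
  have h3 : (∑ c, gridAvg f k (t ++ [c])) / Fintype.card (∀ a, P a) - fanAvg f k t ≤
      Fintype.card (∀ a, P a → P a) * gridIncr f k t := by
    rw [gridIncr_eq, mul_div_cancel₀ _ hM.ne']
    have hid : ∀ π : ∀ a, P a, act (fun _ p => p) π = π := fun _ => rfl
    have h := Finset.single_le_sum (f := fun φ : ∀ a, P a → P a =>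
      (∑ π, gridAvg f k (t ++ [act φ π])) / Fintype.card (∀ a, P a) -
        avg k fun ψ : List (∀ a, P a → P a) =>
          ∏ π : ∀ a, P a, f (t ++ act φ π :: ψ.map (act · π)))
      (fun φ _ => sub_nonneg.2 (avg_fan_le hf k t φ)) (Finset.mem_univ fun _ p => p)
    simpa only [hid, fanAvg] using h
  rw [gridIncr] at h2
  linarith

end Cells

/-! ### Positive upper density and the one-step extension -/

/-- The set `Q` of words has positive upper density. -/
def HasPosDensity {α : Type*} [Fintype α] (Q : Set (List α)) : Prop :=
  ∃ c : ℝ, 0 < c ∧ ∃ᶠ n in atTop, c ≤ avg n (Q.indicator 1)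

lemma HasPosDensity.mono {α : Type*} [Fintype α] {Q R : Set (List α)} (hQ : HasPosDensity Q)
    (h : Q ⊆ R) : HasPosDensity R := by
  obtain ⟨c, hc, hfreq⟩ := hQ
  exact ⟨c, hc, hfreq.mono fun n hn => hn.trans <| avg_mono fun t _ =>
    Set.indicator_le_indicator_of_subset h (fun _ => zero_le_one) t⟩

lemma HasPosDensity.preimage_map {α β : Type*} [Fintype α] [Fintype β] {Q : Set (List β)}
    (hQ : HasPosDensity Q) (e : α ≃ β) : HasPosDensity (List.map e ⁻¹' Q) := by
  obtain ⟨c, hc, hfreq⟩ := hQ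
  refine ⟨c, hc, hfreq.mono fun n hn => hn.trans_eq ?_⟩
  rw [← avg_map_equiv e]
  rfl

section Recurrence

variable {α : Type*} [Fintype α] [Nonempty α]

lemma avg_take_mul_take {m N M : ℕ} (hmN : m ≤ N) (hNM : N ≤ M) (f : List α → ℝ) :
    avg M (fun t => f (t.take m) * f (t.take N)) =
      avg m (fun s => f s * avg (N - m) fun x => f (s ++ x)) := by
  have h := avg_take hNM (fun t => f (t.take m) * f t)
  simp only [List.take_take, min_eq_left hmN] at h
  rw [h]
  obtain ⟨k, rfl⟩ := Nat.exists_eq_add_of_le hmN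
  rw [avg_append]
  refine avg_congr fun s hs => ?_
  subst hs
  simp [avg_const_mul]

lemma eventually_correlation_ge (V : Ultrafilter ℕ) (hV : (V : Filter ℕ) ≤ atTop)
    {f : List α → ℝ} (hf0 : ∀ t, 0 ≤ f t) (hf1 : ∀ t, f t ≤ 1) {c : ℝ} (hc : 0 < c)
    (hcf : ∀ᶠ n in V, c ≤ avg n f) :
    ∀ᶠ m in V, ∀ᶠ N in V,
      c ^ 2 / 2 ≤ avg m (fun s => f s * avg (N - m) fun x => f (s ++ x)) := by
  by_contra hcon
  rw [← Ultrafilter.eventually_not] at hcon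
  set corr : ℕ → ℕ → ℝ := fun m N => avg m (fun s => f s * avg (N - m) fun x => f (s ++ x))
  have hbad : ∀ᶠ m in V, ∀ᶠ N in V, corr m N < c ^ 2 / 2 := by
    filter_upwards [hcon] with m hm
    rw [← Ultrafilter.eventually_not] at hm
    filter_upwards [hm] with N hN using not_le.1 hN
  obtain ⟨e, he, hlt⟩ := exists_seq_of_forall_finset_exists
    (fun m => c ≤ avg m f ∧ ∀ᶠ N in V, corr m N < c ^ 2 / 2)
    (fun m N => m < N ∧ corr m N < c ^ 2 / 2) (fun s hs => by
      have h1 : ∀ᶠ N in V, ∀ m ∈ s, m < N ∧ corr m N < c ^ 2 / 2 := by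
        rw [Filter.eventually_all_finset]
        intro m hm
        exact ((eventually_gt_atTop m).filter_mono hV).and (hs m hm).2
      obtain ⟨N, hN⟩ := ((hcf.and hbad).and h1).exists
      exact ⟨N, hN.1, hN.2⟩)
  have hmono : StrictMono e := fun i j hij => (hlt i j hij).1
  obtain ⟨r, hr⟩ := exists_nat_gt (2 / c ^ 2)
  have hr0 : (0 : ℝ) < r := lt_trans (by positivity) hr
  have hle : ∀ i ∈ Finset.range r, e i ≤ e r := fun i hi =>
    hmono.monotone (Finset.mem_range.1 hi).le
  have hpair : ∀ i ∈ Finset.range r, ∀ j ∈ Finset.range r,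
      avg (e r) (fun t => f (t.take (e i)) * f (t.take (e j))) ≤
        c ^ 2 / 2 + if i = j then 1 else 0 := by
    intro i hi j hj
    rcases lt_trichotomy i j with h | h | h
    · rw [avg_take_mul_take (hmono h).le (hle j hj), if_neg h.ne, add_zero]
      exact (hlt i j h).2.le
    · rw [if_pos h]
      refine (avg_le_one fun t => mul_le_one₀ (hf1 _) (hf0 _) (hf1 _)).trans ?_
      have : 0 < c ^ 2 := by positivity
      linarith
    · simp only [mul_comm (f (List.take (e i) _))]
      rw [avg_take_mul_take (hmono h).le (hle i hi), if_neg h.ne', add_zero]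
      exact (hlt j i h).2.le
  have hsq : 0 ≤ avg (e r) (fun t : List α =>
      (∑ i ∈ Finset.range r, f (t.take (e i)) - r * c) ^ 2) := avg_nonneg fun _ => sq_nonneg _
  have hexp : avg (e r) (fun t : List α =>
      (∑ i ∈ Finset.range r, f (t.take (e i)) - r * c) ^ 2) =
      ∑ i ∈ Finset.range r, ∑ j ∈ Finset.range r,
        avg (e r) (fun t => f (t.take (e i)) * f (t.take (e j))) -
      (2 * (r * c)) * ∑ i ∈ Finset.range r, avg (e r) (fun t => f (t.take (e i))) +
      (r * c) ^ 2 := by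
    have : (fun t : List α => (∑ i ∈ Finset.range r, f (t.take (e i)) - r * c) ^ 2) =
        fun t : List α => (∑ i ∈ Finset.range r, ∑ j ∈ Finset.range r,
          f (t.take (e i)) * f (t.take (e j)) -
          (2 * (r * c)) * ∑ i ∈ Finset.range r, f (t.take (e i))) + (r * c) ^ 2 := by
      ext t
      rw [← Finset.sum_mul_sum]
      ring
    rw [this, avg_add_fun, avg_sub_fun, avg_const_mul, avg_const, avg_sum, avg_sum]
    simp only [avg_sum]
  have h1 : (r : ℝ) * c ≤ ∑ i ∈ Finset.range r, avg (e r) (fun t => f (t.take (e i))) := by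
    have := Finset.sum_le_sum (s := Finset.range r) (f := fun _ => c)
      (g := fun i => avg (e r) (fun t => f (t.take (e i)))) (fun i hi => by
        rw [avg_take (hle i hi)]
        exact (he i).1)
    simpa using this
  have h2 : ∑ i ∈ Finset.range r, ∑ j ∈ Finset.range r,
      avg (e r) (fun t => f (t.take (e i)) * f (t.take (e j))) ≤
        (r : ℝ) ^ 2 * (c ^ 2 / 2) + r := by
    refine (Finset.sum_le_sum fun i hi => Finset.sum_le_sum fun j hj =>
      hpair i hi j hj).trans_eq ?_
    have : ∀ i ∈ Finset.range r, ∑ j ∈ Finset.range r,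
        (c ^ 2 / 2 + if i = j then (1 : ℝ) else 0) = r * (c ^ 2 / 2) + 1 := by
      intro i hi
      rw [Finset.sum_add_distrib, Finset.sum_ite_eq, if_pos hi]
      simp
    rw [Finset.sum_congr rfl this]
    simp
    ring
  have h3 : (2 * (r * c)) * (r * c) ≤
      (2 * (r * c)) * ∑ i ∈ Finset.range r, avg (e r) (fun t => f (t.take (e i))) := by gcongr
  rw [div_lt_iff₀ (by positivity)] at hr
  nlinarith [mul_lt_mul_of_pos_left hr hr0]

end Recurrence

section Step

variable {A : Type*} [Fintype A] [DecidableEq A] {P : A → Type*}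
  [∀ a, Fintype (P a)] [∀ a, DecidableEq (P a)] [∀ a, AddGroup (P a)]

lemma eventually_avg_gridIncr_lt (V : Ultrafilter ℕ) (hV : (V : Filter ℕ) ≤ atTop)
    {f : List (∀ a, P a) → ℝ} (hf0 : ∀ t, 0 ≤ f t) (hf1 : ∀ t, f t ≤ 1) {ε : ℝ} (hε : 0 < ε) :
    ∀ᶠ m in V, ∀ᶠ N in V, avg m (gridIncr f (N - m - 1)) < ε := by
  by_contra hcon
  rw [← Ultrafilter.eventually_not] at hcon
  have hinf : {m | ∀ᶠ N in V, ε ≤ avg m (gridIncr f (N - m - 1))}.Infinite := by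
    refine Nat.frequently_atTop_iff_infinite.1 (Filter.Frequently.filter_mono ?_ hV)
    refine (hcon.mono fun m hm => ?_).frequently
    rw [← Ultrafilter.eventually_not] at hm
    filter_upwards [hm] with N hN using not_lt.1 hN
  obtain ⟨r, hr⟩ := exists_nat_gt (1 / ε)
  obtain ⟨s, hs, hcard⟩ := hinf.exists_subset_card_eq r
  have hev : ∀ᶠ N in V, ∀ m ∈ s, m < N ∧ ε ≤ avg m (gridIncr f (N - m - 1)) := by
    rw [Filter.eventually_all_finset]
    intro m hm
    exact ((eventually_gt_atTop m).filter_mono hV).and (hs hm)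
  obtain ⟨N, hN⟩ := hev.exists
  have hG0 : ∀ k t, 0 ≤ gridAvg f k t := fun k t =>
    avg_nonneg fun _ => Finset.prod_nonneg fun _ _ => hf0 _
  have hG1 : ∀ k t, gridAvg f k t ≤ 1 := fun k t =>
    avg_le_one fun _ => Finset.prod_le_one (fun _ _ => hf0 _) fun _ _ => hf1 _
  have htel : ∀ m ∈ Finset.range N, avg m (gridIncr f (N - m - 1)) =
      avg (m + 1) (gridAvg f (N - (m + 1))) - avg m (gridAvg f (N - m)) := by
    intro m hm
    have h1 : N - m - 1 = N - (m + 1) := by omega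
    have h2 : N - (m + 1) + 1 = N - m := by have := Finset.mem_range.1 hm; omega
    rw [avg_snoc, ← avg_sub_fun, h1]
    refine avg_congr fun t _ => ?_
    rw [gridIncr, h2]
  have hsum : ∑ m ∈ Finset.range N, avg m (gridIncr f (N - m - 1)) ≤ 1 := by
    rw [Finset.sum_congr rfl htel,
      Finset.sum_range_sub (fun m => avg m (gridAvg f (N - m)))]
    have h1 : avg N (gridAvg f (N - N)) ≤ 1 := avg_le_one fun t => hG1 _ t
    have h2 : 0 ≤ avg 0 (gridAvg f (N - 0)) := avg_nonneg fun t => hG0 _ t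
    linarith
  have hsub : s ⊆ Finset.range N := fun m hm => Finset.mem_range.2 (hN m hm).1
  have h1 := Finset.sum_le_sum_of_subset_of_nonneg hsub
    (f := fun m => avg m (gridIncr f (N - m - 1)))
    (fun m _ _ => avg_nonneg fun t => gridIncr_nonneg hf0 _ t)
  have h2 := Finset.card_nsmul_le_sum s (fun m => avg m (gridIncr f (N - m - 1))) ε
    (fun m hm => (hN m hm).2)
  rw [hcard, nsmul_eq_mul] at h2
  rw [div_lt_iff₀ hε] at hr
  linarith

/-- If a set `Q` of words has positive upper density, then above the immediate successors of some
element of `Q` the grids contained in `Q` have positive upper density. -/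
theorem HasPosDensity.exists_fan {Q : Set (List (∀ a, P a))} (hQ : HasPosDensity Q) :
    ∃ s ∈ Q, HasPosDensity
      {ψ : List (∀ a, P a → P a) | ∀ π, s ++ π :: ψ.map (act · π) ∈ Q} := by
  obtain ⟨c, hc, hfreq⟩ := hQ
  have := Filter.frequently_iff_neBot.1 hfreq
  obtain ⟨V, hV⟩ := Ultrafilter.exists_le (atTop ⊓ Filter.principal {n | c ≤ avg n (Q.indicator 1)})
  obtain ⟨hVtop, hVc⟩ := le_inf_iff.1 hV
  have hVc : ∀ᶠ n in V, c ≤ avg n (Q.indicator 1) := Filter.le_principal_iff.1 hVc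
  set f : List (∀ a, P a) → ℝ := Q.indicator 1 with hfdef
  have hf0 : ∀ t, 0 ≤ f t := Set.indicator_nonneg fun _ _ => zero_le_one
  have hf1 : ∀ t, f t ≤ 1 := fun t => Set.indicator_apply_le' (fun _ => le_rfl) fun _ => zero_le_one
  set K := Fintype.card (∀ a, P a)
  set M : ℝ := ((Fintype.card (∀ a, P a → P a) : ℕ) : ℝ)
  have hM : 0 < M := Nat.cast_pos.2 Fintype.card_pos
  set η := c ^ 2 / 4 with hη
  have hη0 : 0 < η := by positivity
  set c' := η ^ K / 2 with hc'
  have hc'0 : 0 < c' := by positivity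
  obtain ⟨m, hm1, hm2⟩ := ((eventually_correlation_ge V hVtop hf0 hf1 hc hVc).and
    (eventually_avg_gridIncr_lt V hVtop hf0 hf1
      (show 0 < η * (c' / M) by positivity))).exists
  have hex : ∀ᶠ N in V, ∃ s : List (∀ a, P a), s.length = m ∧ s ∈ Q ∧
      c' ≤ fanAvg f (N - m - 1) s := by
    filter_upwards [hm1, hm2, (eventually_gt_atTop m).filter_mono hVtop] with N h1 h2 h3
    by_contra! hcon
    have hk : N - m = N - m - 1 + 1 := by omega
    have hpt : ∀ s : List (∀ a, P a), s.length = m →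
        f s * avg (N - m) (fun x => f (s ++ x)) ≤
          η + (M / c') * gridIncr f (N - m - 1) s := by
      intro s hs
      have hI := gridIncr_nonneg hf0 (N - m - 1) s
      have hI' : 0 ≤ (M / c') * gridIncr f (N - m - 1) s := by positivity
      by_cases hsQ : s ∈ Q
      · have hfs : f s = 1 := by simp [hfdef, hsQ]
        rw [hfs, one_mul]
        rcases le_or_gt (avg (N - m) fun x => f (s ++ x)) η with hle | hgt
        · linarith
        · have h4 := cellAvg_pow_le_fanAvg_add hf0 (N - m - 1) s
          rw [← hk] at h4
          have h5 : η ^ K ≤ cellAvg f (N - m) s ^ K := by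
            gcongr
            exact hgt.le
          have h6 := hcon s hs hsQ
          have h7 : avg (N - m) (fun x => f (s ++ x)) ≤ 1 := avg_le_one fun _ => hf1 _
          have h8 : c' ≤ M * gridIncr f (N - m - 1) s := by
            have : c' + c' = η ^ K := by rw [hc']; ring
            linarith
          have h9 : 1 ≤ (M / c') * gridIncr f (N - m - 1) s := by
            rw [div_mul_eq_mul_div, le_div_iff₀ hc'0, one_mul]
            exact h8
          linarith
      · have hfs : f s = 0 := by simp [hfdef, hsQ]
        rw [hfs, zero_mul]
        linarith
    have h4 := avg_mono hpt
    rw [avg_add_fun, avg_const, avg_const_mul] at h4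
    have h5 : (M / c') * avg m (gridIncr f (N - m - 1)) < (M / c') * (η * (c' / M)) := by
      gcongr
    have h6 : (M / c') * (η * (c' / M)) = η := by field_simp
    have h7 : η + η = c ^ 2 / 2 := by rw [hη]; ring
    linarith
  obtain ⟨s, hs, hsQ, hsV⟩ : ∃ s : List (∀ a, P a), s.length = m ∧ s ∈ Q ∧
      ∃ᶠ N in V, c' ≤ fanAvg f (N - m - 1) s := by
    by_contra! hcon
    have hfin : {s : List (∀ a, P a) | s.length = m}.Finite := List.finite_length_eq _ m
    have : ∀ᶠ N in V, ∀ s ∈ {s : List (∀ a, P a) | s.length = m}, s ∈ Q →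
        ¬ c' ≤ fanAvg f (N - m - 1) s := by
      rw [Filter.eventually_all_finite hfin]
      intro s hs
      by_cases hsQ : s ∈ Q
      · filter_upwards [hcon s hs hsQ] with N hN _ using not_le.2 hN
      · exact Filter.Eventually.of_forall fun N h => absurd h hsQ
    obtain ⟨N, ⟨s, hs, hsQ, h⟩, hN⟩ := (hex.and this).exists
    exact hN s hs hsQ h
  refine ⟨s, hsQ, c', hc'0, ?_⟩
  have hfan : ∀ k, fanAvg f k s = avg k (Set.indicator
      {ψ : List (∀ a, P a → P a) | ∀ π, s ++ π :: ψ.map (act · π) ∈ Q} 1) := by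
    intro k
    refine avg_congr fun ψ _ => ?_
    by_cases h : ∀ π, s ++ π :: ψ.map (act · π) ∈ Q
    · rw [Set.indicator_of_mem (by exact h)]
      exact Finset.prod_eq_one fun π _ => Set.indicator_of_mem (h π) _
    · rw [Set.indicator_of_notMem (by exact h)]
      obtain ⟨π, hπ⟩ := not_forall.1 h
      exact Finset.prod_eq_zero (Finset.mem_univ π) (Set.indicator_of_notMem hπ _)
  simp only [← hfan]
  have htend : Tendsto (fun N => N - m - 1) atTop atTop :=
    (tendsto_sub_atTop_nat 1).comp (tendsto_sub_atTop_nat m)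
  exact htend.frequently (hsV.filter_mono hVtop)

end Step

/-! ### Iterating the one-step extension -/

section Iteration

variable {d : ℕ} {b : Fin d → ℕ}

/-- Pairs of a coordinate `i` and a word of length `n` in the alphabet of size `b i`. -/
abbrev NodeIdx (b : Fin d → ℕ) (n : ℕ) : Type := Σ i : Fin d, (Fin n → Fin (b i))

lemma nodeIdx_apply_congr {n : ℕ} (χ : ∀ a : NodeIdx b n, Fin (b a.1)) {i : Fin d}
    {w w' : Fin n → Fin (b i)} (h : w = w') : χ ⟨i, w⟩ = χ ⟨i, w'⟩ := by
  subst h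
  rfl

/-- The words coding extensions, of equal lengths, of the nodes `u i w` (`w` of length `n`) all of
whose products lie in `D`. -/
def gridSet (D : Set (∀ i, List (Fin (b i)))) (n : ℕ)
    (u : ∀ i, List (Fin (b i)) → List (Fin (b i))) :
    Set (List (∀ a : NodeIdx b n, Fin (b a.1))) :=
  {x | ∀ w : ∀ i, Fin n → Fin (b i),
    (fun i => u i (List.ofFn (w i)) ++ x.map (fun π => π ⟨i, w i⟩)) ∈ D}

/-- Evaluation of `(n+1)`-words as pairs of an `n`-word and a last letter. -/
def nodeIdxCurry (b : Fin d → ℕ) (n : ℕ) : (∀ a : NodeIdx b (n + 1), Fin (b a.1)) ≃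
    (∀ a : NodeIdx b n, Fin (b a.1) → Fin (b a.1)) where
  toFun χ a p := χ ⟨a.1, Fin.snoc a.2 p⟩
  invFun ψ a := ψ ⟨a.1, Fin.init a.2⟩ (a.2 (Fin.last n))
  left_inv χ := by
    funext ⟨i, w⟩
    exact nodeIdx_apply_congr χ (Fin.snoc_init_self w)
  right_inv ψ := by
    funext ⟨i, w⟩ p
    dsimp only
    rw [Fin.snoc_last]
    have h : ∀ w', w' = w → ψ ⟨i, w'⟩ p = ψ ⟨i, w⟩ p := by
      rintro _ rfl
      rfl
    exact h _ (Fin.init_snoc (α := fun _ => Fin (b i)) p w)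

variable [∀ i, NeZero (b i)]

lemma exists_step {D : Set (∀ i, List (Fin (b i)))} {n : ℕ}
    {u : ∀ i, List (Fin (b i)) → List (Fin (b i))} (hu : HasPosDensity (gridSet D n u))
    {L : ℕ} (hL : ∀ i w, w.length = n → (u i w).length = L) :
    ∃ v u' : ∀ i, List (Fin (b i)) → List (Fin (b i)), ∃ l : ℕ,
      HasPosDensity (gridSet D (n + 1) u') ∧
      (∀ i w, w.length = n → (v i w).length = l) ∧
      (∀ w : ∀ i, List (Fin (b i)), (∀ i, (w i).length = n) → (fun i => v i (w i)) ∈ D) ∧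
      (∀ i w, u i w <+: v i w) ∧
      (∀ i w p, w.length = n → u' i (w ++ [p]) = v i w ++ [p]) := by
  obtain ⟨s, hs, hdens⟩ := hu.exists_fan
  let v : ∀ i, List (Fin (b i)) → List (Fin (b i)) := fun i w =>
    u i w ++ s.map fun π => π ⟨i, fun j => w.getD j 0⟩
  have hv : ∀ i (w : Fin n → Fin (b i)),
      v i (List.ofFn w) = u i (List.ofFn w) ++ s.map fun π => π ⟨i, w⟩ := by
    intro i w
    have : (fun j : Fin n => (List.ofFn w).getD j 0) = w := by
      ext j
      simp
    exact congrArg (u i (List.ofFn w) ++ ·)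
      (List.map_congr_left fun π _ => nodeIdx_apply_congr π this)
  have hu' : ∀ i (w : List (Fin (b i))) p, w.length = n →
      v i ((w ++ [p]).take n) ++ (w ++ [p]).drop n = v i w ++ [p] := by
    intro i w p hw
    subst hw
    simp
  refine ⟨v, fun i w => v i (w.take n) ++ w.drop n, L + s.length, ?_, ?_, ?_, ?_, hu'⟩
  · refine (hdens.preimage_map (nodeIdxCurry b n)).mono fun x hx w => ?_
    have h := hx (fun a => w a.1 (Fin.last n)) (fun i => Fin.init (w i))
    convert h using 2 with i
    have hw : List.ofFn (w i) = List.ofFn (Fin.init (w i)) ++ [w i (Fin.last n)] := by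
      rw [List.ofFn_succ']
      simp [Fin.init_def]
    dsimp only
    rw [hw, hu' _ _ _ (by simp), hv]
    have hx : ∀ π ∈ x, π ⟨i, w i⟩ = π ⟨i, Fin.snoc (Fin.init (w i)) (w i (Fin.last n))⟩ :=
      fun π _ => nodeIdx_apply_congr π (Fin.snoc_init_self (w i)).symm
    simp [nodeIdxCurry, act, List.map_congr_left hx]
  · intro i w hw
    simp [v, hL i w hw]
  · intro w hw
    have h := hs (fun i j => (w i).get (j.cast (hw i).symm))
    have hofn : ∀ i, List.ofFn (fun j : Fin n => (w i).get (j.cast (hw i).symm)) = w i := by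
      intro i
      refine List.ext_getElem (by simp [hw i]) fun k h1 h2 => by simp
    convert h using 2 with i
    rw [← hv, hofn]
  · intro i w
    exact List.prefix_append _ _

/-- A set of tuples of words of positive upper density contains the level product of a vector
strong subtree, given by its canonical parametrization. -/
theorem exists_strong_embedding {D : Set (∀ i, List (Fin (b i)))}
    (hD : HasPosDensity {x : List (∀ i, Fin (b i)) | (fun i => x.map fun π => π i) ∈ D}) :
    ∃ (σ : ∀ i, List (Fin (b i)) → List (Fin (b i))) (l : ℕ → ℕ),
      (∀ i w, (σ i w).length = l w.length) ∧
      (∀ i w p, σ i w ++ [p] <+: σ i (w ++ [p])) ∧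
      ∀ n (w : ∀ i, List (Fin (b i))), (∀ i, (w i).length = n) → (fun i => σ i (w i)) ∈ D := by
  let State : ℕ → Type := fun n =>
    {u : ∀ i, List (Fin (b i)) → List (Fin (b i)) // HasPosDensity (gridSet D n u) ∧
      ∃ L : ℕ, ∀ i w, w.length = n → (u i w).length = L}
  have hstep : ∀ n (u : State n), ∃ (v : ∀ i, List (Fin (b i)) → List (Fin (b i)))
      (u' : State (n + 1)) (l : ℕ),
      (∀ i w, w.length = n → (v i w).length = l) ∧
      (∀ w : ∀ i, List (Fin (b i)), (∀ i, (w i).length = n) → (fun i => v i (w i)) ∈ D) ∧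
      (∀ i w, u.1 i w <+: v i w) ∧
      (∀ i w p, w.length = n → u'.1 i (w ++ [p]) = v i w ++ [p]) := by
    rintro n ⟨u, hu, L, hL⟩
    obtain ⟨v, u', l, h1, h2, h3, h4, h5⟩ := exists_step hu hL
    refine ⟨v, ⟨u', h1, l + 1, fun i w hw => ?_⟩, l, h2, h3, h4, h5⟩
    obtain ⟨w', p, rfl⟩ := List.eq_nil_or_concat' w |>.resolve_left (by rintro rfl; simp at hw)
    have hw' : w'.length = n := by simpa using hw
    rw [h5 i w' p hw', List.length_append, h2 i w' hw']
    rfl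
  choose v u' l hl hvD hpre hu' using hstep
  let e : (∀ a : NodeIdx b 0, Fin (b a.1)) ≃ (∀ i, Fin (b i)) :=
    { toFun := fun χ i => χ ⟨i, Fin.elim0⟩
      invFun := fun π a => π a.1
      left_inv := fun χ => by
        funext ⟨i, w⟩
        exact nodeIdx_apply_congr χ (Subsingleton.elim _ _)
      right_inv := fun π => rfl }
  have hbase : HasPosDensity (gridSet D 0 fun _ _ => []) := by
    refine (hD.preimage_map e).mono fun x hx w => ?_
    have : (fun i => (x.map e).map fun π => π i) ∈ D := hx
    convert this using 2 with i
    simp only [e, List.nil_append, List.map_map]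
    exact List.map_congr_left fun π _ => nodeIdx_apply_congr π (Subsingleton.elim _ _)
  let st : ∀ n, State n := fun n =>
    Nat.rec ⟨fun _ _ => [], hbase, 0, fun _ _ _ => rfl⟩ (fun n u => u' n u) n
  refine ⟨fun i w => v w.length (st w.length) i w, fun n => l n (st n),
    fun i w => hl _ _ i w rfl, fun i w p => ?_, fun n w hw => ?_⟩
  · have h1 : (w ++ [p]).length = w.length + 1 := by simp
    dsimp only
    rw [h1, ← hu' w.length (st w.length) i w p rfl]
    exact hpre (w.length + 1) (st (w.length + 1)) i (w ++ [p])
  · have h : ∀ i k, k = n → v k (st k) i (w i) = v n (st n) i (w i) := by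
      rintro i _ rfl
      rfl
    simpa only [h _ _ (hw _)] using hvD n (st n) w hw

end Iteration

/-! ### Parametrizations of homogeneous trees -/

section Trees

lemma isPrefix_antisymm {α : Type*} {u v : List α} (h : u <+: v) (h' : v <+: u) : u = v :=
  h.eq_of_length (le_antisymm h.length_le h'.length_le)

lemma isPrefix_map_iff_of_step {α β : Type*} {g : α → β} (hg : Function.Injective g)
    {ι : List α → List β} (h : ∀ w p, ι w ++ [g p] <+: ι (w ++ [p])) (u v : List α) :
    ι u <+: ι v ↔ u <+: v := by
  have mono : ∀ u t, ι u <+: ι (u ++ t) := by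
    intro u t
    induction t using List.reverseRecOn with
    | nil => simp
    | append_singleton t p ih =>
      rw [← List.append_assoc]
      exact ih.trans ((List.prefix_append _ _).trans (h _ p))
  refine ⟨?_, ?_⟩
  · induction u using List.reverseRecOn with
    | nil => simp
    | append_singleton u p ih =>
      intro hp
      obtain ⟨t, rfl⟩ := ih ((mono u [p]).trans hp)
      have h1 : ι u ++ [g p] <+: ι (u ++ t) := (h u p).trans hp
      cases t with
      | nil =>
        have := h1.length_le
        simp at this
      | cons q t =>
        have h2 : ι u ++ [g q] <+: ι (u ++ q :: t) := by
          have := (h u q).trans (mono (u ++ [q]) t)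
          rwa [List.append_assoc] at this
        have h3 := List.prefix_of_prefix_length_le h1 h2 (by simp)
        have h4 : g p = g q := by simpa using h3.eq_of_length (by simp)
        rw [hg h4]
        simp
  · rintro ⟨t, rfl⟩
    exact mono u t

lemma ncard_strict_prefixes {α : Type*} (w : List α) :
    {u | u <+: w ∧ u ≠ w}.ncard = w.length := by
  have : {u | u <+: w ∧ u ≠ w} = (fun k => w.take k) '' Set.Iio w.length := by
    ext u
    constructor
    · rintro ⟨h, hne⟩
      refine ⟨u.length, lt_of_le_of_ne h.length_le fun he => hne (h.eq_of_length he), ?_⟩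
      exact (List.prefix_iff_eq_take.1 h).symm
    · rintro ⟨k, hk, rfl⟩
      refine ⟨List.take_prefix _ _, fun he => ?_⟩
      have := congrArg List.length he
      rw [List.length_take] at this
      have hk' : k < w.length := hk
      omega
  rw [this, Set.InjOn.ncard_image, Set.ncard_Iio_nat]
  intro j hj k hk hjk
  have := congrArg List.length hjk
  have hj' : j < w.length := hj
  have hk' : k < w.length := hk
  simp only [List.length_take] at this
  omega

variable {b : ℕ} {ι : List (Fin b) → List ℕ}

lemma injective_of_isPrefix_iff (hι : ∀ u v, ι u <+: ι v ↔ u <+: v) : Function.Injective ι :=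
  fun u v h => isPrefix_antisymm ((hι u v).1 (h ▸ List.prefix_rfl))
    ((hι v u).1 (h ▸ List.prefix_rfl))

lemma level_range (hι : ∀ u v, ι u <+: ι v ↔ u <+: v) (n : ℕ) :
    level (Set.range ι) n = ι '' {w | w.length = n} := by
  have hinj := injective_of_isPrefix_iff hι
  have hpred : ∀ w, {s ∈ Set.range ι | s <+: ι w ∧ s ≠ ι w}.ncard = w.length := by
    intro w
    have : {s ∈ Set.range ι | s <+: ι w ∧ s ≠ ι w} = ι '' {u | u <+: w ∧ u ≠ w} := by
      ext s
      constructor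
      · rintro ⟨⟨u, rfl⟩, h1, h2⟩
        exact ⟨u, ⟨(hι u w).1 h1, fun h => h2 (h ▸ rfl)⟩, rfl⟩
      · rintro ⟨u, ⟨h1, h2⟩, rfl⟩
        exact ⟨⟨u, rfl⟩, (hι u w).2 h1, fun h => h2 (hinj h)⟩
    rw [this, Set.ncard_image_of_injective _ hinj, ncard_strict_prefixes]
  ext s
  constructor
  · rintro ⟨⟨w, rfl⟩, h⟩
    rw [hpred] at h
    exact ⟨w, h, rfl⟩
  · rintro ⟨w, h, rfl⟩
    refine ⟨⟨w, rfl⟩, ?_⟩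
    rw [hpred]
    exact h

lemma immSuc_range_iff (hι : ∀ u v, ι u <+: ι v ↔ u <+: v) (w : List (Fin b)) (t : List ℕ) :
    ImmSuc (Set.range ι) (ι w) t ↔ ∃ p, t = ι (w ++ [p]) := by
  have hinj := injective_of_isPrefix_iff hι
  constructor
  · rintro ⟨_, ⟨v, rfl⟩, h1, h2, h3⟩
    obtain ⟨t, rfl⟩ := (hι w v).1 h1
    cases t with
    | nil => simp at h2
    | cons p t =>
      refine ⟨p, ?_⟩
      rcases h3 (ι (w ++ [p])) ⟨_, rfl⟩ ((hι _ _).2 (List.prefix_append _ _))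
        ((hι _ _).2 (by simp)) with h | h
      · simpa using hinj h
      · exact h.symm
  · rintro ⟨p, rfl⟩
    refine ⟨⟨w, rfl⟩, ⟨_, rfl⟩, (hι _ _).2 (List.prefix_append _ _),
      fun h => by simpa using hinj h, ?_⟩
    rintro _ ⟨u, rfl⟩ h1 h2
    obtain ⟨t, rfl⟩ := (hι _ _).1 h1
    have h3 := (hι _ _).1 h2
    rw [List.prefix_append_right_inj] at h3
    rcases List.prefix_cons_iff.1 h3 with rfl | ⟨t', rfl, h4⟩
    · simp
    · rw [List.prefix_nil.1 h4]
      exact Or.inr rfl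

lemma immSuc_bSeq {s : List ℕ} (hs : s ∈ bSeq b) {p : ℕ} (hp : p < b) :
    ImmSuc (bSeq b) s (s ++ [p]) := by
  refine ⟨hs, ?_, List.prefix_append _ _, by simp, ?_⟩
  · intro x hx
    rcases List.mem_append.1 hx with h | h
    · exact hs x h
    · rw [List.mem_singleton.1 h]
      exact hp
  · rintro u - ⟨t, rfl⟩ h2
    rw [List.prefix_append_right_inj] at h2
    rcases List.prefix_cons_iff.1 h2 with rfl | ⟨t', rfl, h4⟩
    · simp
    · rw [List.prefix_nil.1 h4]
      exact Or.inr rfl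

/-- A homogeneous tree is canonically parametrized by the full tree of words. -/
lemma IsHomogeneous.exists_param {T : Set (List ℕ)} (hT : IsHomogeneous b T) :
    ∃ ι : List (Fin b) → List ℕ, Set.range ι = T ∧
      ∀ (w : List (Fin b)) (p : Fin b), ι w ++ [(p : ℕ)] <+: ι (w ++ [p]) := by
  obtain ⟨-, l, hsub, ⟨r, hr, hruniq⟩, -, -, hnext⟩ := hT
  have hex : ∀ (s : T) (p : Fin b), ∃ s' : T, ImmSuc T s s' ∧ (s : List ℕ) ++ [(p : ℕ)] <+: s' := by
    rintro ⟨s, hs⟩ p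
    obtain ⟨s', ⟨h1, h2⟩, -⟩ := hnext s hs _ (immSuc_bSeq (hsub hs) p.2)
    exact ⟨⟨s', h1.2.1⟩, h1, h2⟩
  choose next hnext1 hnext2 using hex
  let κ : List (Fin b) → T := fun w => w.foldl next ⟨r, hr.1⟩
  have hκ : ∀ w p, κ (w ++ [p]) = next (κ w) p := fun w p => by simp [κ]
  refine ⟨fun w => κ w, ?_, fun w p => ?_⟩
  · refine Set.Subset.antisymm (by rintro _ ⟨w, rfl⟩; exact (κ w).2) ?_
    intro t ht
    induction hn : t.length using Nat.strong_induction_on generalizing t with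
    | _ n ih =>
      subst hn
      have hfin : {s ∈ T | s <+: t ∧ s ≠ t}.Finite := by
        refine (List.finite_toSet t.inits).subset ?_
        rintro s ⟨-, h, -⟩
        exact (List.mem_inits _ _).2 h
      rcases Set.eq_empty_or_nonempty {s ∈ T | s <+: t ∧ s ≠ t} with hem | hne
      · refine ⟨[], ?_⟩
        have : t ∈ level T 0 := ⟨ht, by rw [hem]; simp⟩
        exact (hruniq t this).symm
      · obtain ⟨s, ⟨hsT, hst, hsne⟩, hmax⟩ := hfin.exists_maximalFor List.length _ hne
        have hlen : s.length < t.length :=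
          lt_of_le_of_ne hst.length_le fun he => hsne (hst.eq_of_length he)
        obtain ⟨w, rfl⟩ := ih _ hlen hsT rfl
        obtain ⟨x, rfl⟩ := hst
        cases x with
        | nil => simp at hsne
        | cons p x =>
          have hp : p < b := hsub ht p (by simp)
          refine ⟨w ++ [⟨p, hp⟩], ?_⟩
          have himm : ImmSuc T (κ w) (κ w ++ p :: x) := by
            refine ⟨hsT, ht, List.prefix_append _ _, by simp, fun u hu h1 h2 => ?_⟩
            by_contra! hcon
            have := hmax ⟨hu, h2, hcon.2⟩ h1.length_le
            exact hcon.1 (h1.eq_of_length (le_antisymm h1.length_le this)).symm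
          obtain ⟨s', -, huniq⟩ := hnext _ hsT _ (immSuc_bSeq (hsub hsT) hp)
          have e1 := huniq _ ⟨himm, by simp⟩
          have e2 := huniq _ ⟨hnext1 (κ w) ⟨p, hp⟩, hnext2 (κ w) ⟨p, hp⟩⟩
          dsimp only
          rw [hκ, e1, e2]
  · dsimp only
    rw [hκ]
    exact hnext2 _ _

lemma isStrongSubtreeWith_range_comp {σ : List (Fin b) → List (Fin b)} {l : ℕ → ℕ}
    (hι : ∀ u v, ι u <+: ι v ↔ u <+: v) (hl : StrictMono l)
    (hlen : ∀ w, (σ w).length = l w.length) (hσ : ∀ w p, σ w ++ [p] <+: σ (w ++ [p])) :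
    IsStrongSubtreeWith (Set.range ι) (Set.range (ι ∘ σ)) l := by
  have hισ : ∀ u v, (ι ∘ σ) u <+: (ι ∘ σ) v ↔ u <+: v := fun u v =>
    (hι _ _).trans (isPrefix_map_iff_of_step Function.injective_id hσ u v)
  refine ⟨Set.range_comp_subset_range _ _, ?_, hl, fun n => ?_, ?_⟩
  · refine ⟨(ι ∘ σ) [], ?_, fun s hs => ?_⟩
    · simp only [level_range hισ]
      exact ⟨[], rfl, rfl⟩
    · simp only [level_range hισ] at hs
      obtain ⟨w, hw, rfl⟩ := hs
      rw [List.length_eq_zero_iff.1 hw]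
  · rw [level_range hισ, level_range hι]
    rintro _ ⟨w, hw, rfl⟩
    refine ⟨σ w, ?_, rfl⟩
    rw [Set.mem_ofPred_eq, hlen, hw]
  · rintro _ ⟨w, rfl⟩ t ht
    obtain ⟨p, rfl⟩ := (immSuc_range_iff hι _ _).1 ht
    refine ⟨(ι ∘ σ) (w ++ [p]), ⟨(immSuc_range_iff hισ _ _).2 ⟨p, rfl⟩,
      (hι _ _).2 (hσ w p)⟩, ?_⟩
    rintro _ ⟨h1, h2⟩
    obtain ⟨q, rfl⟩ := (immSuc_range_iff hισ _ _).1 h1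
    have h3 := List.prefix_of_prefix_length_le ((hι _ _).1 h2) (hσ w q) (by simp)
    have h4 : p = q := by simpa using h3.eq_of_length (by simp)
    rw [h4]

end Trees

lemma vecLevel_density_eq_avg {d : ℕ} {b : Fin d → ℕ} {ι : ∀ i, List (Fin (b i)) → List ℕ}
    (hι : ∀ i u v, ι i u <+: ι i v ↔ u <+: v) (D : Set (Fin d → List ℕ)) (n : ℕ) :
    ((D ∩ vecLevel (fun i => Set.range (ι i)) n).ncard : ℝ) /
        ((vecLevel (fun i => Set.range (ι i)) n).ncard : ℝ) =
      avg n (Set.indicator {x : List (∀ i, Fin (b i)) |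
        (fun i => ι i (x.map fun π => π i)) ∈ D} 1) := by
  classical
  let J : (Fin n → ∀ i, Fin (b i)) → Fin d → List ℕ :=
    fun x i => ι i ((List.ofFn x).map fun π => π i)
  have hJ : Function.Injective J := by
    intro x y hxy
    ext k i
    have h := injective_of_isPrefix_iff (hι i) (congrFun hxy i)
    rw [List.map_ofFn, List.map_ofFn] at h
    exact congrArg Fin.val (congrFun (List.ofFn_injective h) k)
  have hrange : vecLevel (fun i => Set.range (ι i)) n = Set.range J := by
    ext z
    simp only [vecLevel, level_range (hι _), Set.mem_ofPred_eq, Set.mem_image]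
    constructor
    · intro h
      choose w hw hz using h
      refine ⟨fun k i => (w i).get (k.cast (hw i).symm), funext fun i => ?_⟩
      rw [← hz i]
      simp only [J, List.map_ofFn]
      congr 1
      exact List.ext_getElem (by simp [hw i]) fun k h1 h2 => by simp
    · rintro ⟨x, rfl⟩ i
      exact ⟨_, by simp, rfl⟩
  have hinter : D ∩ Set.range J = J '' {x | J x ∈ D} := by
    ext z
    constructor
    · rintro ⟨h, x, rfl⟩
      exact ⟨x, h, rfl⟩
    · rintro ⟨x, h, rfl⟩
      exact ⟨h, x, rfl⟩
  rw [hrange, hinter, Set.ncard_image_of_injective _ hJ, ← Set.image_univ,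
    Set.ncard_image_of_injective _ hJ, Set.ncard_univ, Nat.card_eq_fintype_card, avg_eq_sum,
    Fintype.card_fun, Fintype.card_fin, Nat.cast_pow, Set.ncard_eq_toFinset_card',
    Finset.card_eq_sum_ones, Set.toFinset_ofPred, Finset.sum_filter]
  congr 1
  push_cast
  refine Finset.sum_congr rfl fun x _ => ?_
  simp [Set.indicator_apply, J]

/-- the density Halpern–Läuchli theorem `DHL(d)` for every `d ≥ 1`. -/
theorem density_halpern_lauchli : ∀ d : ℕ, 1 ≤ d → DHL d := by
  intro d hd b T hT D _ hlim
  have hb : ∀ i, NeZero (b i) := fun i => ⟨by have := (hT i).1; omega⟩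
  choose ι hrange hstep using fun i => (hT i).exists_param
  obtain rfl : (fun i => Set.range (ι i)) = T := funext hrange
  have hι : ∀ i u v, ι i u <+: ι i v ↔ u <+: v := fun i =>
    isPrefix_map_iff_of_step Fin.val_injective (hstep i)
  simp only [vecLevel_density_eq_avg hι] at hlim
  have hdens : HasPosDensity {x : List (∀ i, Fin (b i)) |
      (fun i => x.map fun π => π i) ∈
        {w : ∀ i, List (Fin (b i)) | (fun i => ι i (w i)) ∈ D}} := by
    obtain ⟨c, hc0, hc⟩ := exists_between hlim
    refine ⟨c, hc0, (Filter.frequently_lt_of_lt_limsup ?_ hc).mono fun _ h => h.le⟩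
    exact Filter.IsBoundedUnder.isCoboundedUnder_le
      (Filter.isBoundedUnder_of ⟨0, fun n => avg_nonneg
        (Set.indicator_nonneg fun _ _ => zero_le_one)⟩)
  obtain ⟨σ, l, hlen, hσ, hσD⟩ := exists_strong_embedding hdens
  have hl : StrictMono l := by
    refine strictMono_nat_of_lt_succ fun n => ?_
    have h := (hσ ⟨0, hd⟩ (List.replicate n 0) 0).length_le
    simpa [hlen] using h
  refine ⟨fun i => Set.range (ι i ∘ σ i),
    ⟨l, fun i => isStrongSubtreeWith_range_comp (hι i) hl (hlen i) (hσ i)⟩, ?_⟩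
  have hισ : ∀ i u v, (ι i ∘ σ i) u <+: (ι i ∘ σ i) v ↔ u <+: v := fun i u v =>
    (hι i _ _).trans (isPrefix_map_iff_of_step Function.injective_id (hσ i) u v)
  refine Set.iUnion_subset fun n z hz => ?_
  have hz' : ∀ i, z i ∈ (ι i ∘ σ i) '' {w | w.length = n} := fun i => by
    rw [← level_range (hισ i)]
    exact hz i
  choose w hw hwz using hz'
  obtain rfl : (fun i => (ι i ∘ σ i) (w i)) = z := funext hwz
  exact hσD n w hw
end DHLPaper
end

section
/- (Strong subtree version of the Halpern–Läuchli Theorem, HL(d).) For every d ≥ 1, every d-tuple (T_1,…,T_d) of uniquely rooted, finitely branching, pruned trees (subtrees of ℕ^{<ℕ}), every r ≥ 1 and every coloring c : ⊗(T_1,…,T_d) → {0,…,r−1} of the level product, there exists a vector strong subtree (S_1,…,S_d) of (T_1,…,T_d) such that c is constant on the level product ⊗(S_1,…,S_d). -/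
open Filter

namespace DHLPaper

section Ramsey

open Cardinal

/-- If `K` is large compared to the well-order `Λ` and the colour set `C`, every colouring of
pairs from `K` has an end-homogeneous sequence of length `Λ`, with an extra end point `y`. -/
theorem exists_endHomogeneous {K C Λ : Type} [LinearOrder Λ] [WellFoundedLT Λ]
    (hK : #((Λ → C) × Λ) < #K) (f : K → K → C) :
    ∃ (x : Λ → K) (y : K), (∀ ξ, x ξ ≠ y) ∧ ∀ η ξ, η < ξ → f (x η) (x ξ) = f (x η) y := by
  classical
  have : Nonempty K := mk_ne_zero_iff.1 (ne_bot_of_gt hK)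
  let step (y : K) (ξ : Λ) (ih : ∀ η, η < ξ → K) : K :=
    Classical.epsilon fun z => ∀ η (h : η < ξ), f (ih η h) z = f (ih η h) y
  let x (y : K) : Λ → K := WellFounded.fix wellFounded_lt (step y)
  have hx : ∀ y ξ, x y ξ = Classical.epsilon fun z => ∀ η, η < ξ → f (x y η) z = f (x y η) y :=
    fun y ξ => WellFounded.fix_eq wellFounded_lt (step y) ξ
  have hxf : ∀ y η ξ, η < ξ → f (x y η) (x y ξ) = f (x y η) y := by
    intro y η ξ h
    have := Classical.epsilon_spec (p := fun z => ∀ η, η < ξ → f (x y η) z = f (x y η) y)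
      ⟨y, fun _ _ => rfl⟩
    rw [← hx] at this
    exact this η h
  by_contra hcon
  have hmem : ∀ y, ∃ ξ, x y ξ = y := by
    intro y
    by_contra h
    exact hcon ⟨x y, y, not_exists.1 h, hxf y⟩
  choose ξ hξ using hmem
  have hdet : ∀ y y', (∀ η, f (x y η) y = f (x y' η) y') → ∀ η, x y η = x y' η := by
    intro y y' h η
    induction η using WellFoundedLT.induction with
    | ind η ih =>
      rw [hx, hx]
      congr 1
      funext z
      refine propext (forall₂_congr fun ζ hζ => ?_)
      rw [h, ih ζ hζ]
  have hinj : Function.Injective fun y => ((fun η => f (x y η) y, ξ y) : (Λ → C) × Λ) := by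
    intro y y' h
    obtain ⟨h₁, h₂⟩ := Prod.mk.inj h
    have := hdet y y' (congrFun h₁) (ξ y)
    rwa [hξ, h₂, hξ] at this
  exact absurd (mk_le_of_injective hinj) (not_le.2 hK)

/-- For every set of colours there is a type all of whose pair colourings admit
an infinite homogeneous sequence. -/
theorem exists_type_homogeneous_pairs (C : Type) :
    ∃ K : Type, ∀ f : K → K → C, ∃ h : ℕ → K, Function.Injective h ∧
      ∃ e, ∀ i j, i < j → f (h i) (h j) = e := by
  classical
  obtain ⟨Λ, hΛ, hinf⟩ : ∃ Λ : Type, #C < #Λ ∧ Infinite Λ :=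
    ⟨Set (C ⊕ ℕ), (mk_le_of_injective Sum.inl_injective).trans_lt
      ((cantor _).trans_eq (mk_set).symm), inferInstance⟩
  obtain ⟨_, _⟩ := exists_wellFoundedLT Λ
  refine ⟨Set ((Λ → C × Prop) × Λ), fun f => ?_⟩
  obtain ⟨x, y, hxy, hx⟩ := exists_endHomogeneous (Λ := Λ) (C := C × Prop)
    ((cantor _).trans_eq (mk_set).symm) fun a b => (f a b, a = b)
  obtain ⟨e, he⟩ := exists_infinite_fiber (fun η => f (x η) y) hΛ
  let u := Infinite.natEmbedding ((fun η => f (x η) y) ⁻¹' {e})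
  obtain ⟨g, hg | hg⟩ := exists_increasing_or_nonincreasing_subseq (· < ·) fun n => (u n : Λ)
  · have hne : ∀ i j, i < j → x (u (g i)) ≠ x (u (g j)) := fun i j hij heq =>
      hxy _ ((Prod.mk.inj (hx _ _ (hg i j hij))).2.mp heq)
    refine ⟨fun n => x (u (g n)), fun i j hij => ?_, e, fun i j hij => ?_⟩
    · rcases lt_trichotomy i j with h | h | h
      · exact absurd hij (hne i j h)
      · exact h
      · exact absurd hij.symm (hne j i h)
    · exact ((Prod.mk.inj (hx _ _ (hg i j hij))).1).trans (u (g i)).2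
  · exfalso
    refine not_strictAnti_of_wellFoundedLT (fun n => (u (g n) : Λ)) fun m n hmn => ?_
    refine lt_of_le_of_ne (not_lt.1 (hg m n hmn)) fun h => hmn.ne' ?_
    exact g.injective (u.injective (Subtype.ext h))

/-- Product form of `exists_type_homogeneous_pairs`. -/
theorem exists_type_homogeneous_prod (C : Type) (d : ℕ) :
    ∃ K : Type, ∀ F : (Fin d → K) → (Fin d → K) → C, ∃ h : Fin d → ℕ → K,
      (∀ i, Function.Injective (h i)) ∧ ∃ e, ∀ a b : Fin d → ℕ, (∀ i, a i < b i) →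
        F (fun i => h i (a i)) (fun i => h i (b i)) = e := by
  induction d with
  | zero =>
    exact ⟨Unit, fun F => ⟨fun i => i.elim0, fun i => i.elim0, F ![] ![], fun a b _ => by
      congr 1⟩⟩
  | succ d ih =>
    obtain ⟨K, hK⟩ := ih
    obtain ⟨K', hK'⟩ := exists_type_homogeneous_pairs ((Fin d → K) → (Fin d → K) → C)
    refine ⟨K' ⊕ K, fun F => ?_⟩
    obtain ⟨h₀, h₀i, G, hG⟩ := hK' fun x y u v =>
      F (Fin.cons (.inl x) (Sum.inr ∘ u)) (Fin.cons (.inl y) (Sum.inr ∘ v))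
    obtain ⟨h, hi, e, he⟩ := hK G
    refine ⟨Fin.cons (Sum.inl ∘ h₀) fun i => Sum.inr ∘ h i, fun i => ?_, e, fun a b hab => ?_⟩
    · cases i using Fin.cases with
      | zero => exact Sum.inl_injective.comp h₀i
      | succ i => exact Sum.inr_injective.comp (hi i)
    · rw [← he (fun i => a i.succ) (fun i => b i.succ) fun i => hab _, ← hG _ _ (hab 0)]
      congr 1 <;> funext i <;> cases i using Fin.cases <;> rfl

/-- Uniformization: given a system of finite partial functions `(s α, p α)` indexed by `d`-tuples
of a suitably large type `K`, and a colouring `D` of the tuples, there is an infinite grid on which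
`D` is constant and the partial functions are pairwise compatible. -/
theorem exists_type_uniformization (X C : Type) (d : ℕ) :
    ∃ K : Type, ∀ (s : (Fin d → K) → Finset K) (p : (Fin d → K) → K → X) (D : (Fin d → K) → C),
      ∃ h : Fin d → ℕ → K, (∀ i, Function.Injective (h i)) ∧
        (∃ e, ∀ a : Fin d → ℕ, D (fun i => h i (a i)) = e) ∧
        ∀ a b : Fin d → ℕ, ∀ γ ∈ s (fun i => h i (a i)), γ ∈ s (fun i => h i (b i)) →
          p (fun i => h i (a i)) γ = p (fun i => h i (b i)) γ := by
  classical
  obtain ⟨K, hK⟩ := exists_type_homogeneous_prod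
    (((Fin d → Bool) → (Fin d → Bool) → Set (ℕ × ℕ)) × Set (ℕ × X) × C) d
  refine ⟨K, fun s p D => ?_⟩
  have henum : ∀ α, ∃ e : K → ℕ, Set.InjOn e (s α) := fun α =>
    Set.countable_iff_exists_injOn.1 (s α).countable_toSet
  choose e he using henum
  let mix (x y : Fin d → K) (σ : Fin d → Bool) : Fin d → K := fun i => bif σ i then y i else x i
  let pat (α β : Fin d → K) : Set (ℕ × ℕ) :=
    {k | ∃ γ ∈ s α, γ ∈ s β ∧ e α γ = k.1 ∧ e β γ = k.2}
  let graph (α : Fin d → K) : Set (ℕ × X) := {k | ∃ γ ∈ s α, e α γ = k.1 ∧ p α γ = k.2}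
  obtain ⟨h, hi, ⟨E₁, E₂, E₃⟩, hE⟩ := hK fun x y =>
    (fun σ τ => pat (mix x y σ) (mix x y τ), graph x, D x)
  let pt (a : Fin d → ℕ) : Fin d → K := fun i => h i (a i)
  have hgraph : ∀ a, graph (pt a) = E₂ := fun a =>
    (Prod.mk.inj (Prod.mk.inj (hE a (fun i => a i + 1) fun i => Nat.lt_succ_self _)).2).1
  have hD : ∀ a, D (pt a) = E₃ := fun a =>
    (Prod.mk.inj (Prod.mk.inj (hE a (fun i => a i + 1) fun i => Nat.lt_succ_self _)).2).2
  have hpat : ∀ (a b : Fin d → ℕ) (σ τ : Fin d → Bool), (∀ i, a i < b i) →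
      pat (pt fun i => bif σ i then b i else a i) (pt fun i => bif τ i then b i else a i)
        = E₁ σ τ := by
    intro a b σ τ hab
    rw [← (Prod.mk.inj (hE a b hab)).1]
    congr 1 <;> funext i <;> exact Bool.apply_cond (h i)
  -- the pattern of two grid points depends only on the coordinatewise order type
  have htype : ∀ a b a' b' : Fin d → ℕ, (∀ i, (a i < b i ↔ a' i < b' i)) →
      (∀ i, (b i < a i ↔ b' i < a' i)) → pat (pt a) (pt b) = pat (pt a') (pt b') := by
    have key : ∀ a b : Fin d → ℕ, pat (pt a) (pt b)
        = E₁ (fun i => decide (b i < a i)) (fun i => decide (a i < b i)) := by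
      intro a b
      rw [← hpat (fun i => min (a i) (b i))
        (fun i => if a i = b i then a i + 1 else max (a i) (b i))]
      · congr 2 <;> funext i <;> simp only [Bool.cond_decide] <;> grind
      · intro i
        split_ifs <;> grind
    intro a b a' b' h₁ h₂
    rw [key, key]
    simp only [h₁, h₂]
  refine ⟨fun i n => h i (n + 1), fun i => (hi i).comp Nat.succ_injective,
    ⟨E₃, fun a => hD _⟩, fun a b γ hγa hγb => ?_⟩
  change γ ∈ s (pt fun i => a i + 1) at hγa
  change γ ∈ s (pt fun i => b i + 1) at hγb
  change p (pt fun i => a i + 1) γ = p (pt fun i => b i + 1) γ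
  generalize ha' : (fun i => a i + 1) = a' at *
  generalize hb' : (fun i => b i + 1) = b' at *
  have hb0 : ∀ i, 0 < b' i := fun i => by rw [← hb']; exact Nat.succ_pos _
  let m : Fin d → ℕ := fun i =>
    if a' i < b' i then b' i + 1 else if b' i < a' i then 0 else a' i
  have hmem : ((e (pt a') γ, e (pt b') γ) : ℕ × ℕ) ∈ pat (pt a') (pt b') :=
    ⟨γ, hγa, hγb, rfl, rfl⟩
  have ham : pat (pt a') (pt m) = pat (pt a') (pt b') := by
    apply htype <;> intro i <;> have := hb0 i <;> grind
  have hbm : pat (pt b') (pt m) = pat (pt a') (pt b') := by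
    apply htype <;> intro i <;> have := hb0 i <;> grind
  have h₁ := hmem
  rw [← ham] at h₁
  obtain ⟨γ₁, hγ₁a, hγ₁m, hk₁, hl₁⟩ := h₁
  obtain rfl : γ₁ = γ := he _ hγ₁a hγa hk₁
  have h₂ := hmem
  rw [← hbm] at h₂
  obtain ⟨γ₂, hγ₂b, hγ₂m, hk₂, hl₂⟩ := h₂
  obtain rfl : γ₂ = γ₁ := he _ hγ₂m hγ₁m (hl₂.trans hl₁.symm)
  have hg : ((e (pt a') γ₂, p (pt a') γ₂) : ℕ × X) ∈ graph (pt b') := by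
    rw [hgraph, ← hgraph a']
    exact ⟨γ₂, hγa, rfl, rfl⟩
  obtain ⟨δ, hδ, hδe, hδp⟩ := hg
  obtain rfl : δ = γ₂ := he _ hδ hγb (hδe.trans hk₂.symm)
  exact hδp.symm

end Ramsey

section Levels

variable {T : Set (List ℕ)} {s t : List ℕ} {m n : ℕ}

theorem finite_strictPrefixes (T : Set (List ℕ)) (t : List ℕ) :
    {s ∈ T | s <+: t ∧ s ≠ t}.Finite :=
  (List.finite_toSet t.inits).subset fun _ hs => (List.mem_inits _ _).2 hs.2.1

theorem level_lt_of_prefix (hs : s ∈ level T m) (ht : t ∈ level T n) (h : s <+: t) (hne : s ≠ t) :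
    m < n := by
  rw [← hs.2, ← ht.2]
  refine Set.ncard_lt_ncard ⟨fun u hu => ⟨hu.1, hu.2.1.trans h, ?_⟩, fun hsub => ?_⟩
    (finite_strictPrefixes T t)
  · rintro rfl
    exact hu.2.2 (hu.2.1.eq_of_length_le h.length_le)
  · exact (hsub ⟨hs.1, h, hne⟩).2.2 rfl

theorem level_le_of_prefix (hs : s ∈ level T m) (ht : t ∈ level T n) (h : s <+: t) : m ≤ n := by
  by_cases hne : s = t
  · subst hne
    exact (hs.2.symm.trans ht.2).le
  · exact (level_lt_of_prefix hs ht h hne).le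

theorem eq_of_prefix_of_level (hs : s ∈ level T n) (ht : t ∈ level T n) (h : s <+: t) : s = t :=
  by_contra fun hne => (level_lt_of_prefix hs ht h hne).false

theorem eq_of_prefix_prefix {u : List ℕ} (hs : s ∈ level T n) (ht : t ∈ level T n)
    (hsu : s <+: u) (htu : t <+: u) : s = t := by
  rcases List.prefix_or_prefix_of_prefix hsu htu with h | h
  · exact eq_of_prefix_of_level hs ht h
  · exact (eq_of_prefix_of_level ht hs h).symm

theorem level_succ_of_immSuc (hs : s ∈ level T n) (h : ImmSuc T s t) : t ∈ level T (n + 1) := by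
  obtain ⟨hsT, htT, hst, hne, hmax⟩ := h
  refine ⟨htT, ?_⟩
  have hset : {u ∈ T | u <+: t ∧ u ≠ t} = insert s {u ∈ T | u <+: s ∧ u ≠ s} := by
    ext u
    simp only [Set.mem_insert_iff, Set.mem_ofPred_eq]
    constructor
    · rintro ⟨huT, hut, hu⟩
      by_cases hus : u = s
      · exact .inl hus
      · rcases List.prefix_or_prefix_of_prefix hut hst with h | h
        · exact .inr ⟨huT, h, hus⟩
        · exact absurd (hmax u huT h hut) (by tauto)
    · rintro (rfl | ⟨huT, hus, hu⟩)
      · exact ⟨hsT, hst, hne⟩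
      · refine ⟨huT, hus.trans hst, ?_⟩
        rintro rfl
        exact hne (hst.eq_of_length_le hus.length_le)
  rw [hset, Set.ncard_insert_of_notMem (fun h => h.2.2 rfl) (finite_strictPrefixes T s), hs.2]

theorem exists_extension_level (hT : Pruned T) (hs : s ∈ level T n) (hnm : n ≤ m) :
    ∃ t ∈ level T m, s <+: t := by
  induction m, hnm using Nat.le_induction with
  | base => exact ⟨s, hs, List.prefix_rfl⟩
  | succ m _ ih =>
    obtain ⟨t, ht, hst⟩ := ih
    obtain ⟨u, hu⟩ := hT t ht.1
    exact ⟨u, level_succ_of_immSuc ht hu, hst.trans hu.2.2.1⟩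

theorem level_nonempty (hroot : UniquelyRooted T) (hT : Pruned T) (n : ℕ) :
    (level T n).Nonempty := by
  obtain ⟨r, hr, -⟩ := hroot
  obtain ⟨t, ht, -⟩ := exists_extension_level hT hr n.zero_le
  exact ⟨t, ht⟩

end Levels

section Forcing

variable {d : ℕ}

/-- A finite approximation to a `K`-indexed family of branches of each `T i`:
nodes of a common level for the finitely many indices in the support. -/
structure Cond (T : Fin d → Set (List ℕ)) (K : Type) where
  /-- the indices of the branches being approximated -/
  supp : Finset K
  /-- the common level of the approximations -/
  lev : ℕ
  /-- the approximations -/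
  node : Fin d → K → List ℕ
  node_mem : ∀ i, ∀ γ ∈ supp, node i γ ∈ level (T i) lev

namespace Cond

variable {T : Fin d → Set (List ℕ)} {K : Type}

/-- `q.Ext p`: the condition `q` extends `p`. -/
def Ext (q p : Cond T K) : Prop :=
  p.supp ⊆ q.supp ∧ p.lev ≤ q.lev ∧ ∀ i, ∀ γ ∈ p.supp, p.node i γ <+: q.node i γ

theorem Ext.refl (p : Cond T K) : p.Ext p := ⟨subset_rfl, le_rfl, fun _ _ _ => List.prefix_rfl⟩

theorem Ext.trans {p q r : Cond T K} (h₁ : r.Ext q) (h₂ : q.Ext p) : r.Ext p :=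
  ⟨h₂.1.trans h₁.1, h₂.2.1.trans h₁.2.1,
    fun i γ hγ => (h₂.2.2 i γ hγ).trans (h₁.2.2 i γ (h₂.1 hγ))⟩

/-- The tuple of nodes assigned by `p` to the tuple `α` of indices. -/
def tuple (p : Cond T K) (α : Fin d → K) : Fin d → List ℕ := fun i => p.node i (α i)

theorem tuple_mem {p : Cond T K} {α : Fin d → K} (hα : ∀ i, α i ∈ p.supp) :
    p.tuple α ∈ levelProd T :=
  Set.mem_iUnion.2 ⟨p.lev, fun i => p.node_mem i _ (hα i)⟩

theorem exists_ext (hroot : ∀ i, UniquelyRooted (T i)) (hpruned : ∀ i, Pruned (T i))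
    (p : Cond T K) (s : Finset K) (n : ℕ) : ∃ q : Cond T K, q.Ext p ∧ s ⊆ q.supp ∧ n ≤ q.lev := by
  classical
  have key : ∀ i γ, ∃ t ∈ level (T i) (max n p.lev), γ ∈ p.supp → p.node i γ <+: t := by
    intro i γ
    by_cases hγ : γ ∈ p.supp
    · obtain ⟨t, ht, hpt⟩ :=
        exists_extension_level (hpruned i) (p.node_mem i γ hγ) (le_max_right n p.lev)
      exact ⟨t, ht, fun _ => hpt⟩
    · obtain ⟨t, ht⟩ := level_nonempty (hroot i) (hpruned i) (max n p.lev)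
      exact ⟨t, ht, fun h => absurd h hγ⟩
  choose f hf hpf using key
  exact ⟨⟨p.supp ∪ s, max n p.lev, f, fun i γ _ => hf i γ⟩,
    ⟨Finset.subset_union_left, le_max_right _ _, hpf⟩, Finset.subset_union_right, le_max_left _ _⟩

/-- The set `G` of triples `(p, α, ε)`, each read as a promise by `p` that `α` gets
colour `ε`, is consistent: finitely many promises made by conditions that `p` extends can be fulfilled
simultaneously at arbitrarily high levels by extensions of `p`. -/
def Consistent (c : (Fin d → List ℕ) → ℕ) (G : Set (Cond T K × (Fin d → K) × ℕ)) : Prop :=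
  ∀ Q : Finset (Cond T K × (Fin d → K) × ℕ), ↑Q ⊆ G → ∀ p : Cond T K, (∀ x ∈ Q, p.Ext x.1) →
    ∀ n, ∃ q : Cond T K, q.Ext p ∧ n ≤ q.lev ∧ ∀ x ∈ Q, c (q.tuple x.2.1) = x.2.2

theorem exists_maximal_consistent (hroot : ∀ i, UniquelyRooted (T i))
    (hpruned : ∀ i, Pruned (T i)) (c : (Fin d → List ℕ) → ℕ) :
    ∃ G : Set (Cond T K × (Fin d → K) × ℕ), Maximal (Consistent c) G := by
  have hempty : (∅ : Set (Cond T K × (Fin d → K) × ℕ)) ∈ {G | Consistent c G} := by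
    intro Q hQ p _ n
    obtain ⟨q, hqp, -, hn⟩ := exists_ext hroot hpruned p ∅ n
    exact ⟨q, hqp, hn, fun x hx => absurd (hQ hx) (Set.notMem_empty x)⟩
  have hunion : ∀ C ⊆ {G : Set (Cond T K × (Fin d → K) × ℕ) | Consistent c G},
      IsChain (· ⊆ ·) C → C.Nonempty → ⋃₀ C ∈ {G | Consistent c G} := by
    intro C hC hchain hne Q hQ
    obtain ⟨s, hs, hQs⟩ := hchain.directedOn.exists_mem_subset_of_finite_of_subset_sUnion hne
      Q.finite_toSet hQ
    exact hC hs Q hQs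
  obtain ⟨G, -, hG⟩ := zorn_subset_nonempty {G | Consistent c G}
    (fun C hC hchain hne => ⟨⋃₀ C, hunion C hC hchain hne, fun s => Set.subset_sUnion_of_mem⟩)
    ∅ hempty
  exact ⟨G, hG⟩

/-- A maximal consistent family decides the colour of every tuple densely. -/
theorem exists_ext_mem_of_maximal {c : (Fin d → List ℕ) → ℕ} {r : ℕ}
    (hc : ∀ v ∈ levelProd T, c v < r) {G : Set (Cond T K × (Fin d → K) × ℕ)}
    (hG : Maximal (Consistent c) G) (p : Cond T K) (α : Fin d → K) (hα : ∀ i, α i ∈ p.supp) :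
    ∃ q : Cond T K, q.Ext p ∧ ∃ ε, (q, α, ε) ∈ G := by
  classical
  by_contra hcon
  push Not at hcon
  have hblock : ∀ k, ∃ p' : Cond T K, p'.Ext p ∧ ∃ Q : Finset (Cond T K × (Fin d → K) × ℕ),
      ↑Q ⊆ G ∧ (∀ x ∈ Q, p'.Ext x.1) ∧ ∃ n, ∀ q : Cond T K, q.Ext p' → n ≤ q.lev →
        (∀ x ∈ Q, c (q.tuple x.2.1) = x.2.2) → k ≤ c (q.tuple α) := by
    intro k
    induction k with
    | zero => exact ⟨p, .refl p, ∅, by simp, by simp, 0, fun _ _ _ _ => Nat.zero_le _⟩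
    | succ k ih =>
      obtain ⟨p₁, hp₁, Q₁, hQ₁G, hQ₁, n₁, hn₁⟩ := ih
      have hnot : ¬ Consistent c (insert (p₁, α, k) G) := fun h =>
        hcon p₁ hp₁ k (hG.2 h (Set.subset_insert _ _) (Set.mem_insert _ _))
      unfold Consistent at hnot
      push Not at hnot
      obtain ⟨Q, hQG, p₂, hp₂, n₂, hn₂⟩ := hnot
      by_cases hx : (p₁, α, k) ∈ Q
      · have hp₂₁ : p₂.Ext p₁ := hp₂ _ hx
        refine ⟨p₂, hp₂₁.trans hp₁, Q₁ ∪ Q.erase (p₁, α, k), ?_, ?_, max n₁ n₂, ?_⟩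
        · intro x hx
          rcases Finset.mem_union.1 (Finset.mem_coe.1 hx) with h | h
          · exact hQ₁G h
          · obtain ⟨hne, h⟩ := Finset.mem_erase.1 h
            exact (hQG h).resolve_left hne
        · intro x hx
          rcases Finset.mem_union.1 hx with h | h
          · exact hp₂₁.trans (hQ₁ x h)
          · exact hp₂ x (Finset.mem_of_mem_erase h)
        · intro q hq hn hx
          have hk := hn₁ q (hq.trans hp₂₁) ((le_max_left _ _).trans hn)
            fun x h => hx x (Finset.mem_union_left _ h)
          obtain ⟨y, hyQ, hy⟩ := hn₂ q hq ((le_max_right _ _).trans hn)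
          have hy' : y = (p₁, α, k) := by
            by_contra hne
            exact hy (hx y (Finset.mem_union_right _ (Finset.mem_erase.2 ⟨hne, hyQ⟩)))
          subst hy'
          exact lt_of_le_of_ne hk (Ne.symm hy)
      · obtain ⟨q, hq, hn, hqQ⟩ := hG.1 Q
          (fun x h => (hQG h).resolve_left (by rintro rfl; exact hx h)) p₂ hp₂ n₂
        obtain ⟨y, hyQ, hy⟩ := hn₂ q hq hn
        exact absurd (hqQ y hyQ) hy
  obtain ⟨p', hp', Q, hQG, hQ, n, hn⟩ := hblock r
  obtain ⟨q, hq, hnq, hqQ⟩ := hG.1 Q hQG p' hQ n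
  exact absurd (hn q hq hnq hqQ)
    (not_le.2 (hc _ (tuple_mem fun i => (hq.trans hp').1 (hα i))))

end Cond

/-- Dense form of the Halpern–Läuchli theorem: above some node tuple, finitely many prescribed
nodes in each coordinate can always be extended to a common level so that all products
of the extensions receive one fixed colour. -/
theorem exists_dense_monochromatic (T : Fin d → Set (List ℕ))
    (hroot : ∀ i, UniquelyRooted (T i)) (hpruned : ∀ i, Pruned (T i)) (r : ℕ)
    (c : (Fin d → List ℕ) → ℕ) (hc : ∀ v ∈ levelProd T, c v < r) :
    ∃ (n ε : ℕ) (t : Fin d → List ℕ), (∀ i, t i ∈ level (T i) n) ∧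
      ∀ m, n ≤ m → ∀ B : Fin d → Finset (List ℕ),
        (∀ i, ∀ b ∈ B i, b ∈ level (T i) m ∧ t i <+: b) →
        ∃ N, m ≤ N ∧ ∃ u : Fin d → List ℕ → List ℕ,
          (∀ i, ∀ b ∈ B i, u i b ∈ level (T i) N ∧ b <+: u i b) ∧
          ∀ b : Fin d → List ℕ, (∀ i, b i ∈ B i) → c (fun i => u i (b i)) = ε := by
  classical
  obtain ⟨K, hK⟩ :=
    exists_type_uniformization (Fin d → List ℕ) (ℕ × ℕ × (Fin d → List ℕ)) d
  obtain ⟨G, hG⟩ := Cond.exists_maximal_consistent (T := T) (K := K) hroot hpruned c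
  have hdecide : ∀ α : Fin d → K, ∃ (q : Cond T K) (ε : ℕ),
      (∀ i, α i ∈ q.supp) ∧ (q, α, ε) ∈ G := by
    intro α
    obtain ⟨p, -, hp, -⟩ := Cond.exists_ext hroot hpruned
      (⟨∅, 0, fun _ _ => [], by simp⟩ : Cond T K) (Finset.univ.image α) 0
    have hα : ∀ i, α i ∈ p.supp := fun i => hp (Finset.mem_image_of_mem α (Finset.mem_univ i))
    obtain ⟨q, hq, ε, hε⟩ := Cond.exists_ext_mem_of_maximal hc hG p α hα
    exact ⟨q, ε, fun i => hq.1 (hα i), hε⟩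
  choose P ε hP hPG using hdecide
  obtain ⟨h, hinj, ⟨⟨n, ε₀, t⟩, hD⟩, hcompat⟩ := hK (fun α => (P α).supp)
    (fun α γ i => (P α).node i γ) (fun α => ((P α).lev, ε α, (P α).tuple α))
  let pt (a : Fin d → ℕ) : Fin d → K := fun i => h i (a i)
  have hlev : ∀ a, (P (pt a)).lev = n := fun a => (Prod.mk.inj (hD a)).1
  have hε : ∀ a, ε (pt a) = ε₀ := fun a => (Prod.mk.inj (Prod.mk.inj (hD a)).2).1
  have ht : ∀ a i, (P (pt a)).node i (pt a i) = t i := fun a i =>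
    congrFun (Prod.mk.inj (Prod.mk.inj (hD a)).2).2 i
  have hnode : ∀ a i k, h i k ∈ (P (pt a)).supp → (P (pt a)).node i (h i k) = t i := by
    intro a i k hk
    have hik : pt (Function.update a i k) i = h i k := by simp [pt]
    rw [← ht (Function.update a i k) i, hik]
    exact congrFun (hcompat a (Function.update a i k) _ hk
      (hik ▸ hP (pt (Function.update a i k)) i)) i
  refine ⟨n, ε₀, t, fun i => ?_, fun m hm B hB => ?_⟩
  · rw [← ht (fun _ => 0) i, ← hlev fun _ => 0]
    exact (P _).node_mem i _ (hP _ i)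
  obtain ⟨code, hcode⟩ : ∃ code : List ℕ → ℕ, Function.Injective code :=
    exists_injective_nat _
  let A : Finset (Fin d → ℕ) := (Fintype.piFinset B).image fun b i => code (b i)
  have hval : ∀ i γ, ∃ v ∈ level (T i) m, (∀ b ∈ B i, h i (code b) = γ → v = b) ∧
      ∀ a, γ ∈ (P (pt a)).supp → (P (pt a)).node i γ <+: v := by
    intro i γ
    by_cases hγ : ∃ b ∈ B i, h i (code b) = γ
    · obtain ⟨b, hb, rfl⟩ := hγ
      refine ⟨b, (hB i b hb).1, fun b' _ h' => (hcode (hinj i h')).symm, fun a ha => ?_⟩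
      rw [hnode a i _ ha]
      exact (hB i b hb).2
    · by_cases hs : ∃ a, γ ∈ (P (pt a)).supp
      · obtain ⟨a, ha⟩ := hs
        have hmem := (P (pt a)).node_mem i γ ha
        rw [hlev] at hmem
        obtain ⟨v, hv, hpv⟩ := exists_extension_level (hpruned i) hmem hm
        refine ⟨v, hv, fun b hb h' => absurd ⟨b, hb, h'⟩ hγ, fun a' ha' => ?_⟩
        rwa [congrFun (hcompat a' a γ ha' ha) i]
      · obtain ⟨v, hv⟩ := level_nonempty (hroot i) (hpruned i) m
        exact ⟨v, hv, fun b hb h' => absurd ⟨b, hb, h'⟩ hγ, fun a ha => absurd ⟨a, ha⟩ hs⟩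
  choose v hv hvB hvP using hval
  let q₀ : Cond T K := ⟨(A.biUnion fun a => (P (pt a)).supp) ∪
    Finset.univ.biUnion fun i => (B i).image fun b => h i (code b), m, v, fun i γ _ => hv i γ⟩
  have hq₀ : ∀ a ∈ A, q₀.Ext (P (pt a)) := fun a ha =>
    ⟨fun γ hγ => Finset.mem_union_left _ (Finset.mem_biUnion.2 ⟨a, ha, hγ⟩),
      (hlev a).trans_le hm, fun i γ hγ => hvP i γ a hγ⟩
  obtain ⟨q, hq, -, hqc⟩ := hG.1 (A.image fun a => (P (pt a), pt a, ε (pt a)))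
    (by
      intro x hx
      obtain ⟨a, -, rfl⟩ := Finset.mem_image.1 (Finset.mem_coe.1 hx)
      exact hPG _) q₀
    (by
      intro x hx
      obtain ⟨a, ha, rfl⟩ := Finset.mem_image.1 hx
      exact hq₀ a ha) 0
  refine ⟨q.lev, hq.2.1, fun i b => q.node i (h i (code b)), fun i b hb => ?_, fun b hb => ?_⟩
  · have hmem : h i (code b) ∈ q₀.supp := Finset.mem_union_right _
      (Finset.mem_biUnion.2 ⟨i, Finset.mem_univ i, Finset.mem_image_of_mem _ hb⟩)
    refine ⟨q.node_mem i _ (hq.1 hmem), ?_⟩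
    have := hq.2.2 i _ hmem
    rwa [show q₀.node i (h i (code b)) = b from hvB i _ b hb rfl] at this
  · have ha : (fun i => code (b i)) ∈ A :=
      Finset.mem_image_of_mem _ (Fintype.mem_piFinset.2 hb)
    exact (hqc _ (Finset.mem_image_of_mem _ ha)).trans (hε _)

end Forcing

section Fusion

/-- Criterion for the union of a sequence of finite node sets to be a strong subtree. -/
theorem isStrongSubtreeWith_iUnion {T : Set (List ℕ)} {l : ℕ → ℕ} {S : ℕ → Finset (List ℕ)}
    (hl : StrictMono l) {s₀ : List ℕ} (h₀ : S 0 = {s₀}) (hlev : ∀ k, ∀ s ∈ S k, s ∈ level T (l k))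
    (hext : ∀ k, ∀ s ∈ S k, ∀ t, ImmSuc T s t → ∃ s' ∈ S (k + 1), t <+: s')
    (hbelow : ∀ k, ∀ s' ∈ S (k + 1), ∃ s ∈ S k, ∃ t, ImmSuc T s t ∧ t <+: s')
    (huniq : ∀ k, ∀ s ∈ S k, ∀ t, ImmSuc T s t → ∀ s₁ ∈ S (k + 1), ∀ s₂ ∈ S (k + 1),
      t <+: s₁ → t <+: s₂ → s₁ = s₂) :
    IsStrongSubtreeWith T (⋃ k, ↑(S k)) l ∧ ∀ k, level (⋃ k, ↑(S k)) k = ↑(S k) := by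
  set U : Set (List ℕ) := ⋃ k, ↑(S k) with hU
  have hmemU : ∀ {s}, s ∈ U ↔ ∃ k, s ∈ S k := by simp [hU]
  have hindex : ∀ {j k s s'}, s ∈ S j → s' ∈ S k → s <+: s' → j ≤ k := fun hs hs' h =>
    hl.le_iff_le.1 (level_le_of_prefix (hlev _ _ hs) (hlev _ _ hs') h)
  have himm : ∀ {k s s'}, s ∈ S k → s' ∈ S (k + 1) → s <+: s' → ImmSuc U s s' := by
    intro k s s' hs hs' h
    refine ⟨hmemU.2 ⟨k, hs⟩, hmemU.2 ⟨k + 1, hs'⟩, h, ?_, ?_⟩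
    · rintro rfl
      have := hindex hs' hs h
      omega
    · intro w hw hsw hws'
      obtain ⟨j, hj⟩ := hmemU.1 hw
      have h₁ := hindex hs hj hsw
      have h₂ := hindex hj hs' hws'
      obtain rfl | rfl : j = k ∨ j = k + 1 := by omega
      · exact .inl (eq_of_prefix_of_level (hlev _ _ hs) (hlev _ _ hj) hsw).symm
      · exact .inr (eq_of_prefix_of_level (hlev _ _ hj) (hlev _ _ hs') hws')
  have hsub : ∀ k, ∀ s ∈ S k, s ∈ level U k := by
    intro k
    induction k with
    | zero =>
      intro s hs
      refine ⟨hmemU.2 ⟨0, hs⟩, (Set.ncard_eq_zero (finite_strictPrefixes U s)).2 ?_⟩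
      refine Set.eq_empty_of_forall_notMem fun w hw => hw.2.2 ?_
      obtain ⟨j, hj⟩ := hmemU.1 hw.1
      obtain rfl := Nat.le_zero.1 (hindex hj hs hw.2.1)
      exact eq_of_prefix_of_level (hlev _ _ hj) (hlev _ _ hs) hw.2.1
    | succ k ih =>
      intro s' hs'
      obtain ⟨s, hs, t, ht, hts'⟩ := hbelow k s' hs'
      exact level_succ_of_immSuc (ih s hs) (himm hs hs' (ht.2.2.1.trans hts'))
  have hlevel : ∀ k, level U k = ↑(S k) := by
    intro k
    ext s
    refine ⟨fun hs => ?_, hsub k s⟩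
    obtain ⟨j, hj⟩ := hmemU.1 hs.1
    obtain rfl : j = k := (hsub j s hj).2.symm.trans hs.2
    exact hj
  refine ⟨⟨fun s hs => ?_, ⟨s₀, ?_, fun s hs => ?_⟩, hl, fun k s hs => ?_, fun s hs t ht => ?_⟩,
    hlevel⟩
  · obtain ⟨k, hk⟩ := hmemU.1 hs
    exact (hlev k s hk).1
  · rw [hlevel, h₀]
    simp
  · simpa [hlevel, h₀] using hs
  · rw [hlevel] at hs
    exact hlev k s hs
  · obtain ⟨k, hk⟩ := hmemU.1 hs
    obtain ⟨s', hs', hts'⟩ := hext k s hk t ht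
    refine ⟨s', ⟨himm hk hs' (ht.2.2.1.trans hts'), hts'⟩, fun w hw => ?_⟩
    have hwlev := level_succ_of_immSuc (hsub k s hk) hw.1
    rw [hlevel] at hwlev
    exact huniq k s hk t ht w hwlev s' hs' hw.2 hts'

end Fusion

/-- the strong subtree version of the Halpern–Läuchli theorem `HL(d)`. -/
theorem halpern_lauchli (d : ℕ) (hd : 1 ≤ d) (T : Fin d → Set (List ℕ))
    (hroot : ∀ i, UniquelyRooted (T i)) (hfin : ∀ i, FinitelyBranching (T i))
    (hpruned : ∀ i, Pruned (T i)) (r : ℕ) (hr : 1 ≤ r)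
    (c : (Fin d → List ℕ) → ℕ) (hc : ∀ v ∈ levelProd T, c v < r) :
    ∃ S : Fin d → Set (List ℕ), IsVecStrongSubtree T S ∧
      ∃ m < r, ∀ v ∈ levelProd S, c v = m := by
  classical
  obtain ⟨n, ε, t, ht, hdense⟩ := exists_dense_monochromatic T hroot hpruned r c hc
  -- the finite stages of the construction: a level together with node sets on that level
  let Stage := {x : ℕ × (Fin d → Finset (List ℕ)) //
    n ≤ x.1 ∧ ∀ i, ∀ s ∈ x.2 i, s ∈ level (T i) x.1 ∧ t i <+: s}
  have hnext : ∀ x : Stage, ∃ y : Stage, x.1.1 < y.1.1 ∧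
      (∀ b : Fin d → List ℕ, (∀ i, b i ∈ y.1.2 i) → c b = ε) ∧
      (∀ i, ∀ s ∈ x.1.2 i, ∀ b, ImmSuc (T i) s b → ∃ s' ∈ y.1.2 i, b <+: s') ∧
      (∀ i, ∀ s' ∈ y.1.2 i, ∃ s ∈ x.1.2 i, ∃ b, ImmSuc (T i) s b ∧ b <+: s') ∧
      ∀ i, ∀ s ∈ x.1.2 i, ∀ b, ImmSuc (T i) s b → ∀ s₁ ∈ y.1.2 i, ∀ s₂ ∈ y.1.2 i,
        b <+: s₁ → b <+: s₂ → s₁ = s₂ := by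
    rintro ⟨⟨N, S⟩, hN, hS⟩
    have hBfin : ∀ i, {b | ∃ s ∈ S i, ImmSuc (T i) s b}.Finite := by
      intro i
      refine ((S i).finite_toSet.biUnion fun s hs => hfin i s (hS i s hs).1.1).subset ?_
      rintro b ⟨s, hs, hb⟩
      exact Set.mem_biUnion hs hb
    let B : Fin d → Finset (List ℕ) := fun i => (hBfin i).toFinset
    have hmemB : ∀ {i b}, b ∈ B i ↔ ∃ s ∈ S i, ImmSuc (T i) s b := fun {i b} =>
      (hBfin i).mem_toFinset
    have hB : ∀ i, ∀ b ∈ B i, b ∈ level (T i) (N + 1) ∧ t i <+: b := by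
      intro i b hb
      obtain ⟨s, hs, hsb⟩ := hmemB.1 hb
      exact ⟨level_succ_of_immSuc (hS i s hs).1 hsb, (hS i s hs).2.trans hsb.2.2.1⟩
    obtain ⟨M, hM, u, hu, hcol⟩ := hdense (N + 1) (Nat.le_succ_of_le hN) B hB
    have huB : ∀ {i b b'}, b ∈ B i → b' ∈ B i → b <+: u i b' → b = b' := fun hb hb' h =>
      eq_of_prefix_prefix (hB _ _ hb).1 (hB _ _ hb').1 h (hu _ _ hb').2
    refine ⟨⟨⟨M, fun i => (B i).image (u i)⟩, by omega, ?_⟩, hM, ?_, ?_, ?_, ?_⟩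
    · intro i s' hs'
      obtain ⟨b, hb, rfl⟩ := Finset.mem_image.1 hs'
      exact ⟨(hu i b hb).1, (hB i b hb).2.trans (hu i b hb).2⟩
    · intro v hv
      choose b hb hbv using fun i => Finset.mem_image.1 (hv i)
      rw [← funext hbv]
      exact hcol b hb
    · intro i s hs b hb
      have hbB := hmemB.2 ⟨s, hs, hb⟩
      exact ⟨u i b, Finset.mem_image_of_mem _ hbB, (hu i b hbB).2⟩
    · intro i s' hs'
      obtain ⟨b, hb, rfl⟩ := Finset.mem_image.1 hs'
      obtain ⟨s, hs, hsb⟩ := hmemB.1 hb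
      exact ⟨s, hs, b, hsb, (hu i b hb).2⟩
    · intro i s hs b hb s₁ hs₁ s₂ hs₂ h₁ h₂
      have hbB := hmemB.2 ⟨s, hs, hb⟩
      obtain ⟨b₁, hb₁, rfl⟩ := Finset.mem_image.1 hs₁
      obtain ⟨b₂, hb₂, rfl⟩ := Finset.mem_image.1 hs₂
      rw [← huB hbB hb₁ h₁, ← huB hbB hb₂ h₂]
  choose next hnext_lt hnext_col hnext_ext hnext_below hnext_uniq using hnext
  obtain ⟨N₀, hN₀, u, hu, hcol₀⟩ := hdense n le_rfl (fun i => {t i}) fun i b hb => by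
    rw [Finset.mem_singleton.1 hb]
    exact ⟨ht i, List.prefix_rfl⟩
  let start : Stage := ⟨⟨N₀, fun i => {u i (t i)}⟩, hN₀, fun i s hs => by
    rw [Finset.mem_singleton.1 hs]
    exact hu i (t i) (Finset.mem_singleton_self _)⟩
  let stage (k : ℕ) : Stage := next^[k] start
  have hstage : ∀ k, stage (k + 1) = next (stage k) := fun k =>
    Function.iterate_succ_apply' next k start
  have hcol : ∀ k, ∀ b : Fin d → List ℕ, (∀ i, b i ∈ (stage k).1.2 i) → c b = ε := by
    intro k b hb
    cases k with
    | zero =>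
      rw [show b = fun i => u i (t i) from funext fun i => Finset.mem_singleton.1 (hb i)]
      exact hcol₀ t fun i => Finset.mem_singleton_self _
    | succ k =>
      rw [hstage] at hb
      exact hnext_col _ b hb
  have hmono : StrictMono fun k => (stage k).1.1 := strictMono_nat_of_lt_succ fun k => by
    rw [hstage]
    exact hnext_lt _
  have hstrong := fun i => isStrongSubtreeWith_iUnion (T := T i) (S := fun k => (stage k).1.2 i)
    hmono (s₀ := u i (t i)) rfl (fun k s hs => ((stage k).2.2 i s hs).1)
    (fun k => by rw [hstage]; exact hnext_ext _ i)
    (fun k => by rw [hstage]; exact hnext_below _ i)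
    (fun k => by rw [hstage]; exact hnext_uniq _ i)
  refine ⟨fun i => ⋃ k, ↑((stage k).1.2 i), ⟨_, fun i => (hstrong i).1⟩, ε, ?_, ?_⟩
  · rw [← hcol₀ t fun i => Finset.mem_singleton_self _]
    exact hc _ (Set.mem_iUnion.2 ⟨N₀, fun i => (hu i (t i) (Finset.mem_singleton_self _)).1⟩)
  · intro v hv
    obtain ⟨k, hk⟩ := Set.mem_iUnion.1 hv
    refine hcol k v fun i => ?_
    have := hk i
    rw [(hstrong i).2 k] at this
    exact this

end DHLPaper
end
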